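/- If q > p_1, or q = p_1 and the field k has characteristic 0 or prime characteristic > d − q − 1, then property M_{q,p_1} holds for k[L]. -/

import Mathlib

open MvPolynomial

set_option synthInstance.maxHeartbeats 1000000
set_option maxHeartbeats 1000000

noncomputable section

namespace SRWLP

variable (k : Type) [Field k]

/-- An (abstract) simplicial complex on the vertex set `Fin n`:
a collection of finite subsets (faces) closed under passing to subsets. -/
structure SC (n : ℕ) where
  faces : Finset (Finset (Fin n))
  down_closed : ∀ s ∈ faces, ∀ t ⊆ s, t ∈ faces

variable {n : ℕ}

/-- `dimP D = dim D + 1`, i.e. the maximal cardinality of a face of `D`. -/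
def dimP (D : SC n) : ℕ := D.faces.sup Finset.card

/-- The Stanley–Reisner ideal of `D`: the ideal generated by the squarefree
monomials corresponding to non-faces. -/
def srIdeal (D : SC n) : Ideal (MvPolynomial (Fin n) k) :=
  Ideal.span { p | ∃ s : Finset (Fin n), s ∉ D.faces ∧ p = ∏ i ∈ s, X i }

/-- `x_σ`, the product of the variables indexed by the face `σ`. -/
def xFace (σ : Finset (Fin n)) : MvPolynomial (Fin n) k := ∏ i ∈ σ, X i

variable {ι : Type} [Fintype ι]

/-- The degree-`m` graded component of the standard graded algebra
`k[Xᵢ : i ∈ ι] ⧸ J`, as a `k`-submodule. -/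
def qComp (J : Ideal (MvPolynomial ι k)) (m : ℕ) :
    Submodule k (MvPolynomial ι k ⧸ J) :=
  (homogeneousSubmodule ι k m).map (Ideal.Quotient.mkₐ k J).toLinearMap

/-- Graded components indexed by `ℤ` (zero in negative degrees). -/
def qCompZ (J : Ideal (MvPolynomial ι k)) (m : ℤ) :
    Submodule k (MvPolynomial ι k ⧸ J) :=
  if 0 ≤ m then qComp k J m.toNat else ⊥

/-- The Hilbert function of `k[Xᵢ] ⧸ J`. -/
def HFq (J : Ideal (MvPolynomial ι k)) (m : ℕ) : ℕ := Module.finrank k (qComp k J m)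

/-- The Hilbert function, with `ℤ` argument. -/
def HFZ (J : Ideal (MvPolynomial ι k)) (m : ℤ) : ℕ := Module.finrank k (qCompZ k J m)

/-- A property `P` of tuples `c : τ → k` holds *generically* (i.e. for all choices
in a suitable nonempty Zariski-open subset of the affine space `k^τ`) if there is a
nonzero polynomial `g` such that `P c` holds whenever `g` does not vanish at `c`. -/
def Generic (τ : Type) (P : (τ → k) → Prop) : Prop :=
  ∃ g : MvPolynomial τ k, g ≠ 0 ∧ ∀ c : τ → k, eval c g ≠ 0 → P c

/-- The linear form with coefficient tuple `c`. -/
def linForm (c : ι → k) : MvPolynomial ι k := ∑ i, C (c i) * X i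

/-- The ideal `J` together with the `d` linear forms encoded by `c`. -/
def redIdeal (J : Ideal (MvPolynomial ι k)) {d : ℕ} (c : Fin d × ι → k) :
    Ideal (MvPolynomial ι k) :=
  J ⊔ Ideal.span (Set.range fun j : Fin d => linForm k fun i => c (j, i))

/-- `depth (k[Xᵢ]⧸J) ≥ t` : there is a regular sequence of length `t` consisting of
elements of the graded maximal ideal. -/
def depthGE (J : Ideal (MvPolynomial ι k)) (t : ℕ) : Prop :=
  ∃ rs : List (MvPolynomial ι k), rs.length = t ∧
    (∀ f ∈ rs, f ∈ Ideal.span (Set.range (X : ι → MvPolynomial ι k))) ∧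
    RingTheory.Sequence.IsRegular (MvPolynomial ι k ⧸ J)
      (rs.map (Ideal.Quotient.mk J))

/-- `k[Xᵢ]⧸J` is Cohen–Macaulay of Krull dimension `d`. -/
def isCM (J : Ideal (MvPolynomial ι k)) (d : ℕ) : Prop :=
  ringKrullDim (MvPolynomial ι k ⧸ J) = (d : ℕ) ∧ depthGE k J d

/-- The socle of `k[Xᵢ]⧸J` (the annihilator of the graded maximal ideal). -/
def socle (J : Ideal (MvPolynomial ι k)) : Submodule k (MvPolynomial ι k ⧸ J) :=
  ⨅ i : ι, LinearMap.ker (LinearMap.mulLeft k (Ideal.Quotient.mk J (X i)))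

/-- `k[Xᵢ]⧸J` is Artinian Gorenstein: Artinian with one-dimensional socle. -/
def artGor (J : Ideal (MvPolynomial ι k)) : Prop :=
  IsArtinianRing (MvPolynomial ι k ⧸ J) ∧ Module.finrank k (socle k J) = 1

/-- `k[Xᵢ]⧸J` is Gorenstein of Krull dimension `d`: it is Cohen–Macaulay of
dimension `d` and a general Artinian reduction is Artinian Gorenstein. -/
def isGor (J : Ideal (MvPolynomial ι k)) (d : ℕ) : Prop :=
  isCM k J d ∧ Generic k (Fin d × ι) fun c => artGor k (redIdeal k J c)

/-- Multiplication by `ω` from the degree-`m` component to the degree-`(m+1)`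
component of `k[Xᵢ]⧸J` has maximal rank (is injective or surjective). -/
def mulMaxRank (J : Ideal (MvPolynomial ι k)) (ω : MvPolynomial ι k ⧸ J) (m : ℕ) : Prop :=
  (∀ x ∈ qComp k J m, ω * x = 0 → x = 0) ∨
  (∀ y ∈ qComp k J (m + 1), ∃ x ∈ qComp k J m, ω * x = y)

/-- The Weak Lefschetz Property for the Artinian algebra `k[Xᵢ]⧸J`: for a general
linear form `ω`, multiplication `ω : (⧸J)ₘ → (⧸J)ₘ₊₁` has maximal rank for all `m`. -/
def artWLP (J : Ideal (MvPolynomial ι k)) : Prop :=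
  Generic k ι fun c => ∀ m : ℕ,
    mulMaxRank k J (Ideal.Quotient.mk J (linForm k c)) m

/-- The Weak Lefschetz Property for `k[Xᵢ]⧸J` of Krull dimension `d ≥ 1`:
Cohen–Macaulay, and a general Artinian reduction has the WLP. -/
def hasWLP (J : Ideal (MvPolynomial ι k)) (d : ℕ) : Prop :=
  isCM k J d ∧ Generic k (Fin d × ι) fun c => artWLP k (redIdeal k J c)

/-- The Strong Lefschetz Property for the Artinian algebra `k[Xᵢ]⧸J`. -/
def artSLP (J : Ideal (MvPolynomial ι k)) : Prop :=
  ∃ r : ℕ, qComp k J r ≠ ⊥ ∧ (∀ j : ℕ, r < j → qComp k J j = ⊥) ∧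
    (∀ i ≤ r, HFq k J i = HFq k J (r - i)) ∧
    Generic k ι fun c => ∀ i : ℕ, 2 * i ≤ r →
      (∀ x ∈ qComp k J i,
          Ideal.Quotient.mk J (linForm k c) ^ (r - 2 * i) * x = 0 → x = 0) ∧
      (∀ y ∈ qComp k J (r - i), ∃ x ∈ qComp k J i,
          Ideal.Quotient.mk J (linForm k c) ^ (r - 2 * i) * x = y)

/-- The Strong Lefschetz Property for `k[Xᵢ]⧸J` of Krull dimension `d ≥ 1`. -/
def hasSLP (J : Ideal (MvPolynomial ι k)) (d : ℕ) : Prop :=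
  isCM k J d ∧ Generic k (Fin d × ι) fun c => artSLP k (redIdeal k J c)

/-- `D` is Gorenstein* over `k`: every element of the vertex set is a vertex,
`k[D]` is Gorenstein (of dimension `dim D + 1`), and for every vertex `i` there is a
face `τ` with `τ ∪ {i}` not a face. -/
def gorStar (D : SC n) : Prop :=
  (∀ i : Fin n, {i} ∈ D.faces) ∧
  isGor k (srIdeal k D) (dimP D) ∧
  (∀ i : Fin n, ∃ τ ∈ D.faces, insert i τ ∉ D.faces)

/-! `R[T]` is modelled as the polynomial ring in `n+1` variables, the last
variable playing the role of `T`. -/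

/-- The inclusion `R = k[x₁,…,xₙ] → R[T] = k[x₁,…,xₙ,T]`. -/
def toT : MvPolynomial (Fin n) k →ₐ[k] MvPolynomial (Fin (n + 1)) k :=
  rename Fin.castSucc

/-- The variable `T` of `R[T]`. -/
def Tv (n : ℕ) : MvPolynomial (Fin (n + 1)) k := X (Fin.last n)

/-- Extension of an ideal of `R` to `R[T]`. -/
def extI (J : Ideal (MvPolynomial (Fin n) k)) : Ideal (MvPolynomial (Fin (n + 1)) k) :=
  Ideal.map (toT k) J

/-- The ideal `T·J` of `R[T]`, for an ideal `J` of `R`. -/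
def TmulI (J : Ideal (MvPolynomial (Fin n) k)) : Ideal (MvPolynomial (Fin (n + 1)) k) :=
  Ideal.span ((fun f => Tv k n * toT k f) '' (J : Set (MvPolynomial (Fin n) k)))

/-- `I_L = (I_D : x_σ)`, the Stanley–Reisner ideal of the link of `σ` in `D`
(extended to `R`). -/
def linkIdeal (D : SC n) (σ : Finset (Fin n)) : Ideal (MvPolynomial (Fin n) k) :=
  Submodule.colon (srIdeal k D) (Ideal.span {xFace k σ})

/-- `J_st = (I, x_σ, T·I_L) ⊂ R[T]`, the Stanley–Reisner ideal of the stellar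
subdivision `D_σ`. -/
def Jst (D : SC n) (σ : Finset (Fin n)) : Ideal (MvPolynomial (Fin (n + 1)) k) :=
  extI k (srIdeal k D) ⊔ Ideal.span {toT k (xFace k σ)} ⊔ TmulI k (linkIdeal k D σ)

/-- `I_C = (I, T^{q+1}, T·I_L) ⊂ R[T]`. -/
def IC (D : SC n) (σ : Finset (Fin n)) (q : ℕ) : Ideal (MvPolynomial (Fin (n + 1)) k) :=
  extI k (srIdeal k D) ⊔ Ideal.span {Tv k n ^ (q + 1)} ⊔ TmulI k (linkIdeal k D σ)

/-- `I_G = (I, T^{q+1} - x_σ, T·I_L) ⊂ R[T]`. -/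
def IG (D : SC n) (σ : Finset (Fin n)) (q : ℕ) : Ideal (MvPolynomial (Fin (n + 1)) k) :=
  extI k (srIdeal k D) ⊔ Ideal.span {Tv k n ^ (q + 1) - toT k (xFace k σ)} ⊔
    TmulI k (linkIdeal k D σ)

/-- The ideal of `R[T]` generated by `d` general linear forms of `R`
(involving only the `x`-variables). -/
def xForms {d : ℕ} (c : Fin d × Fin n → k) : Ideal (MvPolynomial (Fin (n + 1)) k) :=
  Ideal.span (Set.range fun j : Fin d => toT k (linForm k fun i => c (j, i)))

/-- Property `M_{q,p₁}` for the Artinian algebra `B = R⧸J_B`: for a general linear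
form `ω`, multiplication by `ω^q : B_{p₁-q} → B_{p₁}` is injective. -/
def propM (JB : Ideal (MvPolynomial (Fin n) k)) (q p₁ : ℕ) : Prop :=
  Generic k (Fin n) fun c => ∀ x ∈ qCompZ k JB ((p₁ : ℤ) - (q : ℤ)),
    Ideal.Quotient.mk JB (linForm k c) ^ q * x = 0 → x = 0


/-- `rs` is a (weakly) regular sequence on the quotient `R ⧸ J`, phrased inside `R`. -/
def RegSeq {R : Type} [CommRing R] : Ideal R → List R → Prop
  | _, [] => True
  | J, r :: rs => (∀ x, r * x ∈ J → x ∈ J) ∧ RegSeq (J ⊔ Ideal.span {r}) rs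

/-- `b` is regular modulo each of the ideals `J + (r₁, …, rᵢ)` with `i < rs.length`. -/
def RegAlong {R : Type} [CommRing R] (b : R) : Ideal R → List R → Prop
  | _, [] => True
  | J, r :: rs => (∀ x, b * x ∈ J → x ∈ J) ∧ RegAlong b (J ⊔ Ideal.span {r}) rs

lemma regSeq_of_isWeaklyRegular {R : Type} [CommRing R] (rs : List R) :
    ∀ (N : Type) [AddCommGroup N] [Module R N] (φ : R →ₗ[R] N) (J : Ideal R),
      Function.Surjective φ → (∀ x, φ x = 0 ↔ x ∈ J) →
      RingTheory.Sequence.IsWeaklyRegular N rs → RegSeq J rs := by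
  induction rs with
  | nil => intros; trivial
  | cons r rs ih =>
    intro N _ _ φ J hφ hJ h
    rw [RingTheory.Sequence.isWeaklyRegular_cons_iff] at h
    refine ⟨fun x hx => ?_, ih (QuotSMulTop r N) ((Submodule.mkQ _).comp φ) _ ?_ ?_ h.2⟩
    · rw [← hJ] at hx ⊢
      have : r • φ x = r • 0 := by
        rw [← map_smul, smul_eq_mul, hx, smul_zero]
      exact h.1 this
    · exact (Submodule.mkQ_surjective _).comp hφ
    · intro x
      simp only [LinearMap.comp_apply, Submodule.mkQ_apply, Submodule.Quotient.mk_eq_zero]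
      constructor
      · intro hx
        obtain ⟨y, -, hy⟩ := Submodule.mem_smul_pointwise_iff_exists _ _ _ |>.1 hx
        obtain ⟨z, rfl⟩ := hφ y
        have : x - r * z ∈ J := by
          rw [← hJ, map_sub, ← smul_eq_mul, map_smul, hy, sub_self]
        rw [← sub_add_cancel x (r * z)]
        exact add_mem (Ideal.mem_sup_left this)
          (Ideal.mem_sup_right (Ideal.mul_mem_right _ _ (Ideal.mem_span_singleton_self r)))
      · intro hx
        obtain ⟨j, hj, z, hz, rfl⟩ := Submodule.mem_sup.1 hx
        obtain ⟨w, rfl⟩ := Ideal.mem_span_singleton.1 hz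
        rw [map_add, (hJ j).2 hj, zero_add, ← smul_eq_mul, map_smul]
        exact Submodule.smul_mem_pointwise_smul _ _ _ trivial

lemma RegAlong.sup_regSeq {R : Type} [CommRing R] (b : R) (rs : List R) :
    ∀ J : Ideal R, RegSeq J rs → RegAlong b J rs →
      RegSeq (J ⊔ Ideal.span {b}) rs.dropLast := by
  induction rs with
  | nil => intros; trivial
  | cons a rs ih =>
    intro J h1 h2
    cases rs with
    | nil => trivial
    | cons a' rs =>
      refine ⟨fun x hx => ?_, ?_⟩
      · obtain ⟨j, hj, z, hz, hjz⟩ := Submodule.mem_sup.1 hx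
        obtain ⟨y, rfl⟩ := Ideal.mem_span_singleton.1 hz
        have hy : y ∈ J ⊔ Ideal.span {a} := by
          refine h2.2.1 y ?_
          rw [show b * y = - j + x * a by rw [mul_comm x, ← hjz]; ring]
          exact add_mem (Ideal.mem_sup_left (neg_mem hj))
            (Ideal.mem_sup_right (Ideal.mul_mem_left _ _ (Ideal.mem_span_singleton_self a)))
        obtain ⟨i, hi, z', hz', hy'⟩ := Submodule.mem_sup.1 hy
        obtain ⟨y', rfl⟩ := Ideal.mem_span_singleton.1 hz'
        have : x - b * y' ∈ J := by
          refine h1.1 _ ?_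
          rw [show a * (x - b * y') = j + b * i by linear_combination -hjz - b * hy']
          exact add_mem hj (Ideal.mul_mem_left _ _ hi)
        rw [← sub_add_cancel x (b * y')]
        exact add_mem (Ideal.mem_sup_left this)
          (Ideal.mem_sup_right (Ideal.mul_mem_right _ _ (Ideal.mem_span_singleton_self b)))
      · have := ih _ h1.2 h2.2
        rw [sup_right_comm] at this
        exact this

section Density

variable {k : Type} [Field k] {n : ℕ}

lemma exists_linForm_regular (J : Ideal (MvPolynomial (Fin n) k)) (r : MvPolynomial (Fin n) k)
    (hr : r ∈ Ideal.span (Set.range (X : Fin n → MvPolynomial (Fin n) k)))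
    (hreg : ∀ x, r * x ∈ J → x ∈ J) :
    ∃ g : MvPolynomial (Fin n) k, g ≠ 0 ∧ ∀ c : Fin n → k, eval c g ≠ 0 →
      ∀ x, linForm k c * x ∈ J → x ∈ J := by
  classical
  have hfin : (associatedPrimes (MvPolynomial (Fin n) k) (MvPolynomial (Fin n) k ⧸ J)).Finite :=
    associatedPrimes.finite (MvPolynomial (Fin n) k) (MvPolynomial (Fin n) k ⧸ J)
  have key : ∀ p ∈ associatedPrimes (MvPolynomial (Fin n) k) (MvPolynomial (Fin n) k ⧸ J),
      ∃ g : MvPolynomial (Fin n) k, g ≠ 0 ∧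
      ∀ c : Fin n → k, eval c g ≠ 0 → linForm k c ∉ p := by
    intro p hp
    have hrp : r ∉ p := by
      intro hrp
      have : r ∈ ⋃ p ∈ associatedPrimes (MvPolynomial (Fin n) k) (MvPolynomial (Fin n) k ⧸ J),
          (p : Set (MvPolynomial (Fin n) k)) := by
        simp only [Set.mem_iUnion]
        exact ⟨p, hp, hrp⟩
      rw [biUnion_associatedPrimes_eq_compl_regular] at this
      apply this
      show IsSMulRegular (MvPolynomial (Fin n) k ⧸ J) r
      rw [isSMulRegular_iff_right_eq_zero_of_smul]
      intro x hx
      obtain ⟨x, rfl⟩ := Ideal.Quotient.mk_surjective x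
      rw [Ideal.Quotient.eq_zero_iff_mem]
      refine hreg x ?_
      rw [← Ideal.Quotient.eq_zero_iff_mem]
      exact hx
    let L : (Fin n → k) →ₗ[k] MvPolynomial (Fin n) k :=
      { toFun := fun c => linForm k c
        map_add' := by intro a b; simp [linForm, add_mul, Finset.sum_add_distrib]
        map_smul' := by
          intro a b
          simp only [linForm, Finset.smul_sum, smul_eq_C_mul, mul_assoc, Pi.smul_apply,
            smul_eq_mul, map_mul, RingHom.id_apply] }
    let V : Submodule k (Fin n → k) := (p.restrictScalars k).comap L
    have hV : V < ⊤ := by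
      rw [lt_top_iff_ne_top]
      intro hV
      apply hrp
      refine (Ideal.span_le.2 ?_) hr
      rintro _ ⟨i, rfl⟩
      have : Pi.single i 1 ∈ V := by rw [hV]; trivial
      have h2 : L (Pi.single i 1) ∈ p := this
      simpa [L, linForm, Pi.single_apply] using h2
    obtain ⟨f, hf0, hf⟩ := Submodule.exists_le_ker_of_lt_top V hV
    refine ⟨linForm k fun i => f (Pi.single i 1), ?_, ?_⟩
    · intro h0
      apply hf0
      ext i
      have := congrArg (eval (Pi.single i (1 : k))) h0
      simpa [linForm, Pi.single_apply] using this
    · intro c hc hcp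
      apply hc
      have h1 : f c = 0 := hf (show c ∈ V from hcp)
      rw [LinearMap.pi_apply_eq_sum_univ f c] at h1
      simp only [linForm, map_sum, map_mul, eval_C, eval_X]
      rw [← h1]
      refine Finset.sum_congr rfl fun i _ => ?_
      rw [smul_eq_mul, mul_comm]
      congr 2
      ext j
      simp [Pi.single_apply, eq_comm]
  choose! g hg0 hg using key
  refine ⟨∏ p ∈ hfin.toFinset, g p, ?_, ?_⟩
  · exact Finset.prod_ne_zero_iff.2 fun p hp => hg0 p (hfin.mem_toFinset.1 hp)
  · intro c hc x hx
    rw [map_prod, Finset.prod_ne_zero_iff] at hc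
    have hmem : linForm k c ∉ ⋃ p ∈ associatedPrimes (MvPolynomial (Fin n) k) (MvPolynomial (Fin n) k ⧸ J),
          (p : Set (MvPolynomial (Fin n) k)) := by
      simp only [Set.mem_iUnion, not_exists]
      exact fun p hp => hg p hp c (hc p (hfin.mem_toFinset.2 hp))
    rw [biUnion_associatedPrimes_eq_compl_regular, Set.notMem_compl_iff] at hmem
    have hmem' : IsSMulRegular (MvPolynomial (Fin n) k ⧸ J) (linForm k c) := hmem
    rw [isSMulRegular_iff_right_eq_zero_of_smul] at hmem'
    rw [← Ideal.Quotient.eq_zero_iff_mem]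
    refine hmem' _ ?_
    rw [← Ideal.Quotient.eq_zero_iff_mem] at hx
    exact hx

lemma exists_regAlong (rs : List (MvPolynomial (Fin n) k))
    (hrs : ∀ r ∈ rs, r ∈ Ideal.span (Set.range (X : Fin n → MvPolynomial (Fin n) k))) :
    ∀ J : Ideal (MvPolynomial (Fin n) k), RegSeq J rs →
    ∃ g : MvPolynomial (Fin n) k, g ≠ 0 ∧ ∀ c : Fin n → k, eval c g ≠ 0 →
      RegAlong (linForm k c) J rs := by
  induction rs with
  | nil => exact fun J _ => ⟨1, one_ne_zero, fun _ _ => trivial⟩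
  | cons r rs ih =>
    intro J h
    obtain ⟨g1, hg1, h1⟩ := exists_linForm_regular J r (hrs r (by simp)) h.1
    obtain ⟨g2, hg2, h2⟩ := ih (fun r hr => hrs r (by simp [hr])) _ h.2
    refine ⟨g1 * g2, mul_ne_zero hg1 hg2, fun c hc => ?_⟩
    rw [map_mul] at hc
    exact ⟨h1 c (left_ne_zero_of_mul hc), h2 c (right_ne_zero_of_mul hc)⟩

/-- Over an infinite field, sequences of linear forms which are regular modulo `J` are
Zariski dense as soon as some regular sequence of the same length exists. -/
lemma exists_linForms_regSeq [Infinite k] (t : ℕ) :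
    ∀ (J : Ideal (MvPolynomial (Fin n) k)) (rs : List (MvPolynomial (Fin n) k)),
    rs.length = t →
    (∀ r ∈ rs, r ∈ Ideal.span (Set.range (X : Fin n → MvPolynomial (Fin n) k))) →
    RegSeq J rs → ∀ h : MvPolynomial (Fin t × Fin n) k, h ≠ 0 →
    ∃ c : Fin t × Fin n → k, eval c h ≠ 0 ∧
      RegSeq J (List.ofFn fun j => linForm k fun i => c (j, i)) := by
  induction t with
  | zero =>
    intro J rs _ _ _ h hh
    have : ∃ c, eval c h ≠ 0 := by
      by_contra! hc
      exact hh (MvPolynomial.funext fun c => by rw [hc c, map_zero])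
    obtain ⟨c, hc⟩ := this
    exact ⟨c, hc, by simp [RegSeq]⟩
  | succ t ih =>
    intro J rs hlen hmem hreg h hh
    have : ∃ c, eval c h ≠ 0 := by
      by_contra! hc
      exact hh (MvPolynomial.funext fun c => by rw [hc c, map_zero])
    obtain ⟨c, hc⟩ := this
    obtain ⟨g, hg0, hg⟩ := exists_regAlong rs hmem J hreg
    let h₀ : MvPolynomial (Fin n) k :=
      aeval (fun p : Fin (t + 1) × Fin n =>
        if p.1 = 0 then X p.2 else C (c p)) h
    have hev : ∀ a : Fin n → k, eval a h₀ =
        eval (fun p : Fin (t + 1) × Fin n => if p.1 = 0 then a p.2 else c p) h := by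
      intro a
      simp only [h₀, aeval_def, eval_eval₂, algebraMap_eq]
      rw [eval]
      congr 1
      · ext; simp
      · funext p; split_ifs <;> simp
    have hh₀ : h₀ ≠ 0 := by
      intro h0
      apply hc
      have := hev fun i => c (0, i)
      rw [h0, map_zero] at this
      rw [this]
      congr 2
      funext p
      split_ifs with hp
      · rw [← hp]
      · rfl
    have : ∃ a, eval a (g * h₀) ≠ 0 := by
      by_contra! hc
      exact mul_ne_zero hg0 hh₀ (MvPolynomial.funext fun c => by rw [hc c, map_zero])
    obtain ⟨a, ha⟩ := this
    rw [map_mul] at ha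
    have ha1 := hg a (left_ne_zero_of_mul ha)
    have ha2 := right_ne_zero_of_mul ha
    rw [hev] at ha2
    have hdrop := ha1.sup_regSeq (linForm k a) rs J hreg
    let h₁ : MvPolynomial (Fin t × Fin n) k :=
      aeval (fun p : Fin (t + 1) × Fin n =>
        Fin.cases (motive := fun _ => MvPolynomial (Fin t × Fin n) k)
          (C (a p.2)) (fun j => X (j, p.2)) p.1) h
    have hev₁ : ∀ e : Fin t × Fin n → k, eval e h₁ =
        eval (fun p : Fin (t + 1) × Fin n =>
          Fin.cases (motive := fun _ => k) (a p.2) (fun j => e (j, p.2)) p.1) h := by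
      intro e
      simp only [h₁, aeval_def, eval_eval₂, algebraMap_eq]
      rw [eval]
      congr 1
      · ext; simp
      · funext p
        obtain ⟨j, i⟩ := p
        refine Fin.cases ?_ (fun j => ?_) j <;> simp
    have hh₁ : h₁ ≠ 0 := by
      intro h0
      apply ha2
      have := hev₁ fun p => c (p.1.succ, p.2)
      rw [h0, map_zero] at this
      rw [this]
      congr 2
      funext p
      obtain ⟨j, i⟩ := p
      refine Fin.cases ?_ (fun j => ?_) j <;> simp
    obtain ⟨e, he, hreg'⟩ := ih (J ⊔ Ideal.span {linForm k a}) rs.dropLast (by simp [hlen])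
      (fun r hr => hmem r (List.dropLast_subset rs hr)) hdrop h₁ hh₁
    rw [hev₁] at he
    refine ⟨_, he, ?_⟩
    rw [List.ofFn_succ]
    refine ⟨?_, hreg'⟩
    cases rs with
    | nil => simp at hlen
    | cons r rs => exact ha1.1

end Density

section Graded

variable {k : Type} [Field k] {n : ℕ}

/-- An ideal of a polynomial ring containing the homogeneous components of its elements. -/
def HomIdeal (I : Ideal (MvPolynomial (Fin n) k)) : Prop :=
  ∀ p ∈ I, ∀ m, homogeneousComponent m p ∈ I

lemma homogeneousComponent_homogeneous_mul {f : MvPolynomial (Fin n) k} {e : ℕ}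
    (hf : f.IsHomogeneous e) (g : MvPolynomial (Fin n) k) (N : ℕ) :
    homogeneousComponent N (f * g) =
      if e ≤ N then f * homogeneousComponent (N - e) g else 0 := by
  conv_lhs => rw [← sum_homogeneousComponent g]
  rw [Finset.mul_sum, map_sum]
  have h : ∀ i, homogeneousComponent N (f * homogeneousComponent i g) =
      if N = e + i then f * homogeneousComponent i g else 0 := fun i => by
    rw [homogeneousComponent_of_mem ((mem_homogeneousSubmodule _ _).2
      (hf.mul (homogeneousComponent_isHomogeneous i g)))]
  simp only [h]
  split_ifs with hN
  · rw [Finset.sum_eq_single (N - e)]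
    · rw [if_pos (by omega)]
    · intro i _ hi
      rw [if_neg (by omega)]
    · intro hi
      rw [Finset.mem_range, not_lt] at hi
      rw [homogeneousComponent_eq_zero _ _ (by omega), mul_zero, ite_self]
  · refine Finset.sum_eq_zero fun i _ => ?_
    rw [if_neg (by omega)]

lemma homIdeal_span {S : Set (MvPolynomial (Fin n) k)}
    (hS : ∀ s ∈ S, ∃ e, IsHomogeneous s e) : HomIdeal (Ideal.span S) := by
  intro p hp m
  induction hp using Submodule.span_induction generalizing m with
  | mem x hx =>
    obtain ⟨e, he⟩ := hS x hx
    rw [homogeneousComponent_of_mem ((mem_homogeneousSubmodule _ _).2 he)]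
    split_ifs
    · exact Ideal.subset_span hx
    · exact zero_mem _
  | zero => rw [map_zero]; exact zero_mem _
  | add x y _ _ hx hy => rw [map_add]; exact add_mem (hx m) (hy m)
  | smul a x _ hx' =>
    rw [smul_eq_mul, ← sum_homogeneousComponent a, Finset.sum_mul, map_sum]
    refine sum_mem fun i _ => ?_
    rw [homogeneousComponent_homogeneous_mul (homogeneousComponent_isHomogeneous i a)]
    split_ifs
    · exact Ideal.mul_mem_left _ _ (hx' _)
    · exact zero_mem _

lemma HomIdeal.sup {I J : Ideal (MvPolynomial (Fin n) k)} (hI : HomIdeal I) (hJ : HomIdeal J) :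
    HomIdeal (I ⊔ J) := by
  intro p hp m
  obtain ⟨x, hx, y, hy, rfl⟩ := Submodule.mem_sup.1 hp
  rw [map_add]
  exact add_mem (Ideal.mem_sup_left (hI x hx m)) (Ideal.mem_sup_right (hJ y hy m))

lemma isHomogeneous_linForm (c : Fin n → k) : (linForm k c).IsHomogeneous 1 :=
  IsHomogeneous.sum _ _ _ fun i _ => isHomogeneous_C_mul_X _ i

lemma isHomogeneous_xFace (s : Finset (Fin n)) : (xFace k s).IsHomogeneous s.card := by
  have := IsHomogeneous.prod s (fun i => (X i : MvPolynomial (Fin n) k)) (fun _ => 1)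
    fun i _ => isHomogeneous_X k i
  simpa [xFace] using this

lemma homIdeal_srIdeal (D : SC n) : HomIdeal (srIdeal k D) :=
  homIdeal_span <| by
    rintro _ ⟨s, -, rfl⟩
    exact ⟨_, isHomogeneous_xFace s⟩

lemma homIdeal_linkIdeal (D : SC n) (σ : Finset (Fin n)) : HomIdeal (linkIdeal k D σ) := by
  intro p hp m
  have h : ∀ p, p ∈ linkIdeal k D σ ↔ xFace k σ * p ∈ srIdeal k D := fun p => by
    simp [linkIdeal, mul_comm]
  rw [h] at hp ⊢
  have := homIdeal_srIdeal D _ hp (m + σ.card)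
  rw [homogeneousComponent_homogeneous_mul (isHomogeneous_xFace σ), if_pos (by omega),
    Nat.add_sub_cancel] at this
  exact this

/-- Variables are nilpotent modulo a homogeneous ideal with Artinian quotient. -/
lemma exists_X_pow_mem {J : Ideal (MvPolynomial (Fin n) k)} (hJ : HomIdeal J)
    [Module.Finite k (MvPolynomial (Fin n) k ⧸ J)] (v : Fin n) :
    ∃ r : ℕ, (X v : MvPolynomial (Fin n) k) ^ r ∈ J := by
  obtain ⟨P, hP, h⟩ := Algebra.IsAlgebraic.isAlgebraic (R := k)
    (Ideal.Quotient.mk J (X v : MvPolynomial (Fin n) k))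
  have h1 : Polynomial.aeval (X v : MvPolynomial (Fin n) k) P ∈ J := by
    rw [← Ideal.Quotient.eq_zero_iff_mem, ← h]
    exact (Polynomial.aeval_algHom_apply (Ideal.Quotient.mkₐ k J) _ _).symm
  obtain ⟨m, hm⟩ : ∃ m, P.coeff m ≠ 0 := by
    by_contra! hc
    exact hP (Polynomial.ext (by simpa using hc))
  refine ⟨m, ?_⟩
  have h2 := hJ _ h1 m
  rw [Polynomial.aeval_eq_sum_range, map_sum, Finset.sum_eq_single m] at h2
  · rw [map_smul, homogeneousComponent_of_mem ((mem_homogeneousSubmodule _ _).2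
      (isHomogeneous_X_pow v m)), if_pos rfl, smul_eq_C_mul] at h2
    have := J.mul_mem_left (C (P.coeff m)⁻¹) h2
    rwa [← mul_assoc, ← C_mul, inv_mul_cancel₀ hm, C_1, one_mul] at this
  · intro i _ hi
    rw [map_smul, homogeneousComponent_of_mem ((mem_homogeneousSubmodule _ _).2
      (isHomogeneous_X_pow v i)), if_neg (Ne.symm hi), smul_zero]
  · intro hi
    rw [Finset.mem_range, not_lt] at hi
    rw [Polynomial.coeff_eq_zero_of_natDegree_lt (by omega), zero_smul, map_zero]

lemma exists_mul_mem_socle {J : Ideal (MvPolynomial (Fin n) k)}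
    (hJ : ∀ v, ∃ r : ℕ, (X v : MvPolynomial (Fin n) k) ^ r ∈ J) {p : MvPolynomial (Fin n) k}
    (hp : p ∉ J) (s : Finset (Fin n)) :
    ∃ m, p * m ∉ J ∧ ∀ v ∈ s, X v * (p * m) ∈ J := by
  classical
  induction s using Finset.induction_on with
  | empty => exact ⟨1, by simpa using hp, by simp⟩
  | insert v s _ ih =>
    obtain ⟨m, hm, hs⟩ := ih
    have hex : ∃ r : ℕ, p * m * X v ^ r ∈ J := by
      obtain ⟨r, hr⟩ := hJ v
      exact ⟨r, J.mul_mem_left _ hr⟩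
    have h0 : Nat.find hex ≠ 0 := by
      intro h0
      have := Nat.find_spec hex
      rw [h0, pow_zero, mul_one] at this
      exact hm this
    obtain ⟨r, hr⟩ := Nat.exists_eq_succ_of_ne_zero h0
    refine ⟨m * X v ^ r, ?_, ?_⟩
    · rw [← mul_assoc]
      exact Nat.find_min hex (by omega)
    · intro w hw
      rcases Finset.mem_insert.1 hw with rfl | hw
      · have := Nat.find_spec hex
        rw [hr, pow_succ] at this
        convert this using 1
        ring
      · convert J.mul_mem_right (X v ^ r) (hs w hw) using 1
        ring

/-- In an Artinian Gorenstein quotient every nonzero ideal contains the socle. -/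
lemma artGor.exists_socle {J : Ideal (MvPolynomial (Fin n) k)} (hJ : HomIdeal J)
    (h : artGor k J) :
    ∃ z, z ∉ J ∧ ∀ p, p ∉ J → ∃ m, p * m - z ∈ J := by
  have := h.1
  have : Module.Finite k (MvPolynomial (Fin n) k ⧸ J) := (Module.finite_iff_isArtinianRing _ _).2 h.1
  obtain ⟨⟨z', hz'⟩, hz0, -⟩ := finrank_eq_one_iff'.1 h.2
  obtain ⟨z, rfl⟩ := Ideal.Quotient.mk_surjective z'
  refine ⟨z, ?_, fun p hp => ?_⟩
  · intro hz
    exact hz0 (Subtype.ext (Ideal.Quotient.eq_zero_iff_mem.2 hz))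
  · obtain ⟨m, hm, hs⟩ := exists_mul_mem_socle (exists_X_pow_mem hJ) hp Finset.univ
    have hmem : Ideal.Quotient.mk J (p * m) ∈ socle k J := by
      rw [socle, Submodule.mem_iInf]
      intro v
      rw [LinearMap.mem_ker, LinearMap.mulLeft_apply, ← map_mul,
        Ideal.Quotient.eq_zero_iff_mem]
      exact hs v (Finset.mem_univ v)
    have hne : (⟨_, hmem⟩ : socle k J) ≠ 0 := fun h0 =>
      hm (Ideal.Quotient.eq_zero_iff_mem.1 (congrArg Subtype.val h0))
    obtain ⟨a, ha⟩ := (finrank_eq_one_iff_of_nonzero' _ hne).1 h.2 ⟨_, hz'⟩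
    refine ⟨m * C a, ?_⟩
    rw [← Ideal.Quotient.eq_zero_iff_mem, map_sub, sub_eq_zero]
    have ha' := congrArg Subtype.val ha
    rw [← mul_assoc, mul_comm, ← smul_eq_C_mul]
    exact ha'

end Graded

section Functionals

variable {k : Type} [Field k] {n : ℕ}

lemma RegSeq.eq_zero_of_sum_mem {R : Type} [CommRing R] [Algebra k R] {β : Type} [Fintype β]
    (b : β → R) {d : ℕ} :
    ∀ (J : Ideal R) (f : Fin d → R), RegSeq J (List.ofFn f) →
      (∀ t : β → k, ∑ i, algebraMap k R (t i) * b i ∈ J ⊔ Ideal.span (Set.range f) → t = 0) →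
      ∀ s : β → MvPolynomial (Fin d) k, ∑ i, aeval f (s i) * b i ∈ J → s = 0 := by
  induction d with
  | zero =>
    intro J f _ hb s hs
    have h0 := hb (fun i => constantCoeff (s i)) (by
      refine Ideal.mem_sup_left ?_
      convert hs using 3 with i
      conv_rhs => rw [eq_C_of_isEmpty (s i)]
      rw [aeval_C]; rfl)
    funext i
    rw [eq_C_of_isEmpty (s i)]
    have := congrFun h0 i
    simp only [Pi.zero_apply] at this ⊢
    rw [← constantCoeff_eq, this, C_0]
  | succ d ih =>
    intro J f hf hb s hs
    rw [List.ofFn_succ] at hf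
    have hspan : J ⊔ Ideal.span {f 0} ⊔ Ideal.span (Set.range fun j : Fin d => f j.succ) =
        J ⊔ Ideal.span (Set.range f) := by
      rw [sup_assoc, ← Ideal.span_union]
      congr 2
      ext x
      simp only [Set.singleton_union, Set.mem_insert_iff, Set.mem_range, Fin.exists_fin_succ]
      simp [eq_comm]
    have ih' := ih (J ⊔ Ideal.span {f 0}) (fun j => f j.succ) hf.2 (by rwa [hspan])
    let ev : Polynomial (MvPolynomial (Fin d) k) →+* R :=
      Polynomial.eval₂RingHom (aeval fun j : Fin d => f j.succ).toRingHom (f 0)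
    have hev : ∀ p : MvPolynomial (Fin (d + 1)) k, aeval f p = ev (finSuccEquiv k d p) := by
      intro p
      induction p using MvPolynomial.induction_on with
      | C a =>
        have h := (finSuccEquiv k d).commutes a
        rw [algebraMap_eq, Polynomial.algebraMap_apply, algebraMap_eq] at h
        rw [h]
        simp [ev]
      | add p q hp hq => rw [map_add, map_add, map_add, hp, hq]
      | mul_X p i hp =>
        rw [map_mul, map_mul, map_mul, hp, aeval_X]
        congr 1
        refine Fin.cases ?_ (fun j => ?_) i
        · simp [ev, finSuccEquiv_X_zero]
        · simp [ev, finSuccEquiv_X_succ]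
    have key : ∀ m : ℕ, ∀ P : β → Polynomial (MvPolynomial (Fin d) k),
        ∑ i, ev (P i) * b i ∈ J → ∀ i, (P i).coeff m = 0 := by
      have hdiv : ∀ P : Polynomial (MvPolynomial (Fin d) k),
          ev P = f 0 * ev P.divX + aeval (fun j : Fin d => f j.succ) (P.coeff 0) := by
        intro P
        conv_lhs => rw [← Polynomial.divX_mul_X_add P]
        rw [map_add, map_mul, mul_comm]
        simp only [ev, Polynomial.coe_eval₂RingHom, Polynomial.eval₂_X, Polynomial.eval₂_C]
        rfl
      have hzero : ∀ P : β → Polynomial (MvPolynomial (Fin d) k),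
          ∑ i, ev (P i) * b i ∈ J → ∀ i, (P i).coeff 0 = 0 := by
        intro P hP i
        refine congrFun (ih' (fun i => (P i).coeff 0) ?_) i
        have h2 : ∑ i, aeval (fun j : Fin d => f j.succ) ((P i).coeff 0) * b i =
            ∑ i, ev (P i) * b i - f 0 * ∑ i, ev (P i).divX * b i := by
          rw [Finset.mul_sum, ← Finset.sum_sub_distrib]
          refine Finset.sum_congr rfl fun i _ => ?_
          rw [hdiv (P i)]
          ring
        rw [h2]
        exact sub_mem (Ideal.mem_sup_left hP) (Ideal.mem_sup_right
          (Ideal.mul_mem_right _ _ (Ideal.mem_span_singleton_self _)))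
      intro m
      induction m with
      | zero => exact hzero
      | succ m ihm =>
        intro P hP i
        rw [← Polynomial.coeff_divX]
        refine ihm (fun i => (P i).divX) (hf.1 _ ?_) i
        convert hP using 1
        rw [Finset.mul_sum]
        refine Finset.sum_congr rfl fun i _ => ?_
        rw [hdiv (P i), hzero P hP i, map_zero, add_zero, mul_assoc]
    funext i
    apply (finSuccEquiv k d).injective
    rw [Pi.zero_apply, map_zero]
    ext1 m
    rw [Polynomial.coeff_zero]
    refine key m (fun i => finSuccEquiv k d (s i)) ?_ i
    simpa only [hev] using hs

/-- Homogeneous generators modulo `I + (f)` generate over `k[f]` modulo `I`. -/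
lemma exists_sub_sum_mem {I : Ideal (MvPolynomial (Fin n) k)} (hI : HomIdeal I) {d : ℕ}
    (f : Fin d → MvPolynomial (Fin n) k) (hf : ∀ j, (f j).IsHomogeneous 1)
    {β : Type} [Fintype β] (b : β → MvPolynomial (Fin n) k)
    (hb : ∀ i, ∃ e, (b i).IsHomogeneous e)
    (hspan : ∀ p, ∃ t : β → k, p - ∑ i, C (t i) * b i ∈ I ⊔ Ideal.span (Set.range f))
    (p : MvPolynomial (Fin n) k) :
    ∃ s : β → MvPolynomial (Fin d) k, p - ∑ i, aeval f (s i) * b i ∈ I := by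
  choose e he using hb
  have hadd : ∀ p q, (∃ s : β → MvPolynomial (Fin d) k, p - ∑ i, aeval f (s i) * b i ∈ I) →
      (∃ s : β → MvPolynomial (Fin d) k, q - ∑ i, aeval f (s i) * b i ∈ I) →
      ∃ s : β → MvPolynomial (Fin d) k, p + q - ∑ i, aeval f (s i) * b i ∈ I := by
    rintro p q ⟨s, hs⟩ ⟨t, ht⟩
    refine ⟨s + t, ?_⟩
    convert add_mem hs ht using 1
    simp only [Pi.add_apply, map_add, add_mul, Finset.sum_add_distrib]
    ring
  have hsum : ∀ (T : Type) (S : Finset T) (g : T → MvPolynomial (Fin n) k),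
      (∀ j ∈ S, ∃ s : β → MvPolynomial (Fin d) k, g j - ∑ i, aeval f (s i) * b i ∈ I) →
      ∃ s : β → MvPolynomial (Fin d) k, ∑ j ∈ S, g j - ∑ i, aeval f (s i) * b i ∈ I := by
    classical
    intro T S g
    induction S using Finset.induction_on with
    | empty => exact fun _ => ⟨0, by simp⟩
    | insert a S ha ih =>
      intro h
      rw [Finset.sum_insert ha]
      exact hadd _ _ (h a (by simp)) (ih fun j hj => h j (by simp [hj]))
  have hom : ∀ N : ℕ, ∀ p : MvPolynomial (Fin n) k, p.IsHomogeneous N →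
      ∃ s : β → MvPolynomial (Fin d) k, p - ∑ i, aeval f (s i) * b i ∈ I := by
    intro N
    induction N using Nat.strong_induction_on with
    | _ N ih =>
      intro p hp
      obtain ⟨t, ht⟩ := hspan p
      obtain ⟨x, hx, y, hy, hxy⟩ := Submodule.mem_sup.1 ht
      obtain ⟨g, rfl⟩ := (Ideal.mem_span_range_iff_exists_fun).1 hy
      have hN := congrArg (homogeneousComponent N) hxy
      rw [map_add, map_sub, homogeneousComponent_eq_self hp, map_sum, map_sum] at hN
      have hb' : ∀ i, homogeneousComponent N (C (t i) * b i) =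
          aeval f (if N = e i then C (t i) else 0 : MvPolynomial (Fin d) k) * b i := by
        intro i
        rw [homogeneousComponent_C_mul, homogeneousComponent_of_mem
          ((mem_homogeneousSubmodule _ _).2 (he i))]
        split_ifs <;> simp [algebraMap_eq]
      have hg : ∀ j, homogeneousComponent N (g j * f j) =
          if 1 ≤ N then f j * homogeneousComponent (N - 1) (g j) else 0 := fun j => by
        rw [mul_comm, homogeneousComponent_homogeneous_mul (hf j)]
      simp only [hb', hg] at hN
      have hp' : p = (homogeneousComponent N x +
          ∑ i, aeval f (if N = e i then C (t i) else 0 : MvPolynomial (Fin d) k) * b i) +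
          ∑ j, if 1 ≤ N then f j * homogeneousComponent (N - 1) (g j) else 0 := by
        linear_combination -hN
      rw [hp']
      refine hadd _ _ ⟨fun i => if N = e i then C (t i) else 0, ?_⟩ (hsum _ _ _ fun j _ => ?_)
      · rw [add_sub_cancel_right]
        exact hI x hx N
      · split_ifs with h1
        · obtain ⟨s, hs⟩ := ih (N - 1) (by omega) _
            (homogeneousComponent_isHomogeneous (N - 1) (g j))
          refine ⟨fun i => X j * s i, ?_⟩
          convert I.mul_mem_left (f j) hs using 1
          rw [mul_sub, Finset.mul_sum]
          simp only [map_mul, aeval_X, mul_assoc]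
        · exact ⟨0, by simp⟩
  rw [← sum_homogeneousComponent p]
  exact hsum _ _ _ fun i _ => hom i _ (homogeneousComponent_isHomogeneous i p)

/-- A finite dimensional quotient of a polynomial ring has a basis of monomials. -/
lemma exists_monomial_basis (J : Ideal (MvPolynomial (Fin n) k))
    [Module.Finite k (MvPolynomial (Fin n) k ⧸ J)] :
    ∃ (β : Type) (_ : Fintype β) (b : β → MvPolynomial (Fin n) k),
      (∀ i, ∃ e, (b i).IsHomogeneous e) ∧
      (∀ p, ∃ t : β → k, p - ∑ i, C (t i) * b i ∈ J) ∧
      ∀ t : β → k, ∑ i, C (t i) * b i ∈ J → t = 0 := by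
  obtain ⟨B, hBs, hspan, hli⟩ := exists_linearIndependent k
    (Set.range fun e : Fin n →₀ ℕ => Ideal.Quotient.mk J (monomial e (1 : k)))
  have := hli.finite
  have := Fintype.ofFinite B
  choose e he using fun x : B => hBs x.2
  have key : ∀ t : B → k, Ideal.Quotient.mk J (∑ i, C (t i) * monomial (e i) (1 : k)) =
      ∑ i, t i • (i : MvPolynomial (Fin n) k ⧸ J) := by
    intro t
    rw [map_sum]
    refine Finset.sum_congr rfl fun i _ => ?_
    rw [← smul_eq_C_mul, ← he i]
    rfl
  refine ⟨B, inferInstance, fun i => monomial (e i) 1,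
    fun i => ⟨_, isHomogeneous_monomial _ rfl⟩, fun p => ?_, fun t ht => ?_⟩
  · have hp : Ideal.Quotient.mk J p ∈ Submodule.span k B := by
      rw [hspan, p.as_sum, map_sum]
      refine sum_mem fun v _ => ?_
      have : Ideal.Quotient.mk J (monomial v (coeff v p)) =
          coeff v p • Ideal.Quotient.mk J (monomial v (1 : k)) := by
        rw [← mul_one (coeff v p), ← smul_eq_mul, ← smul_monomial, smul_eq_mul, mul_one]
        rfl
      rw [this]
      exact Submodule.smul_mem _ _ (Submodule.subset_span ⟨v, rfl⟩)
    rw [← Subtype.range_val (s := B), Submodule.mem_span_range_iff_exists_fun] at hp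
    obtain ⟨t, ht⟩ := hp
    refine ⟨t, ?_⟩
    rw [← Ideal.Quotient.eq_zero_iff_mem, map_sub, key, ht, sub_self]
  · rw [← Ideal.Quotient.eq_zero_iff_mem, key] at ht
    funext i
    exact Fintype.linearIndependent_iff.1 hli t ht i

end Functionals

section Pairing

variable {k : Type} [Field k] {n d : ℕ}

/-- Additive maps `k[x] ⧸ I → k[y]` which are linear over `k[y]` acting through `f`. -/
def IsFunctional (I : Ideal (MvPolynomial (Fin n) k)) (f : Fin d → MvPolynomial (Fin n) k)
    (Φ : MvPolynomial (Fin n) k →+ MvPolynomial (Fin d) k) : Prop :=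
  (∀ p ∈ I, Φ p = 0) ∧ ∀ s p, Φ (aeval f s * p) = s * Φ p

lemma IsFunctional.constantCoeff_eq_zero {I : Ideal (MvPolynomial (Fin n) k)}
    {f : Fin d → MvPolynomial (Fin n) k}
    {Φ : MvPolynomial (Fin n) k →+ MvPolynomial (Fin d) k} (hΦ : IsFunctional I f Φ)
    {p : MvPolynomial (Fin n) k} (hp : p ∈ I ⊔ Ideal.span (Set.range f)) :
    constantCoeff (Φ p) = 0 := by
  obtain ⟨x, hx, y, hy, rfl⟩ := Submodule.mem_sup.1 hp
  obtain ⟨g, rfl⟩ := (Ideal.mem_span_range_iff_exists_fun).1 hy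
  rw [map_add, hΦ.1 x hx, zero_add, map_sum, map_sum]
  refine Finset.sum_eq_zero fun j _ => ?_
  have := hΦ.2 (X j) (g j)
  rw [aeval_X] at this
  rw [mul_comm, this, map_mul, constantCoeff_X, zero_mul]

/-- For a linear system of parameters `f` with Gorenstein reduction, `k[x] ⧸ I` is torsion free
over `k[f]`, and functionals not vanishing at the socle generator `z` define nondegenerate
pairings. -/
lemma exists_isFunctional {I : Ideal (MvPolynomial (Fin n) k)} (hI : HomIdeal I)
    {f : Fin d → MvPolynomial (Fin n) k} (hf : ∀ j, (f j).IsHomogeneous 1)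
    (hreg : RegSeq I (List.ofFn f)) (hart : artGor k (I ⊔ Ideal.span (Set.range f))) :
    (∀ s : MvPolynomial (Fin d) k, s ≠ 0 → ∀ p, aeval f s * p ∈ I → p ∈ I) ∧
    ∃ z, (∃ Φ, IsFunctional I f Φ ∧ constantCoeff (Φ z) ≠ 0) ∧
      ∀ Φ, IsFunctional I f Φ → constantCoeff (Φ z) ≠ 0 → ∀ p, p ∉ I → ∃ m, Φ (p * m) ≠ 0 := by
  classical
  have hJ : HomIdeal (I ⊔ Ideal.span (Set.range f)) := hI.sup <| homIdeal_span <| by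
    rintro _ ⟨j, rfl⟩
    exact ⟨1, hf j⟩
  have := hart.1
  have : Module.Finite k (MvPolynomial (Fin n) k ⧸ (I ⊔ Ideal.span (Set.range f))) :=
    (Module.finite_iff_isArtinianRing _ _).2 hart.1
  obtain ⟨β, _, b, hbh, hbs, hbi⟩ := exists_monomial_basis (I ⊔ Ideal.span (Set.range f))
  obtain ⟨z, hz, hzm⟩ := hart.exists_socle hJ
  have ind := RegSeq.eq_zero_of_sum_mem b I f hreg hbi
  choose co hco using exists_sub_sum_mem hI f hf b hbh hbs
  have hco_eq : ∀ p s, p - ∑ i, aeval f (s i) * b i ∈ I → co p = s := by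
    intro p s h
    rw [← sub_eq_zero]
    apply ind
    convert sub_mem h (hco p) using 1
    simp only [Pi.sub_apply, map_sub, sub_mul, Finset.sum_sub_distrib]
    ring
  have co_add : ∀ p q, co (p + q) = co p + co q := fun p q => by
    apply hco_eq
    convert add_mem (hco p) (hco q) using 1
    simp only [Pi.add_apply, map_add, add_mul, Finset.sum_add_distrib]
    ring
  have co_mul : ∀ s p, co (aeval f s * p) = fun i => s * co p i := fun s p => by
    apply hco_eq
    convert I.mul_mem_left (aeval f s) (hco p) using 1
    rw [mul_sub, Finset.mul_sum]
    simp only [map_mul, mul_assoc]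
  have co_zero : ∀ p, p ∈ I ↔ co p = 0 := fun p => by
    constructor
    · intro hp
      apply hco_eq
      simpa using hp
    · intro hp
      have := hco p
      rw [hp] at this
      simpa using this
  refine ⟨fun s hs p hp => ?_, z, ?_, fun Φ hΦ hΦz p hp => ?_⟩
  · rw [co_zero] at hp ⊢
    rw [co_mul] at hp
    funext i
    exact (mul_eq_zero.1 (congrFun hp i)).resolve_left hs
  · have : ∃ i, constantCoeff (co z i) ≠ 0 := by
      by_contra! h
      apply hz
      rw [← sub_add_cancel z (∑ i, aeval f (co z i) * b i)]
      refine add_mem (Ideal.mem_sup_left (hco z)) (sum_mem fun i _ =>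
        Ideal.mul_mem_right _ _ (Ideal.mem_sup_right ?_))
      have hmem : co z i ∈ Ideal.span (Set.range (X : Fin d → MvPolynomial (Fin d) k)) := by
        rw [← Set.image_univ, mem_ideal_span_X_image]
        intro m hm
        by_contra! hm0
        have : m = 0 := by
          ext j
          simpa using hm0 j
        rw [this, mem_support_iff] at hm
        exact hm (h i)
      have := Ideal.mem_map_of_mem (aeval f : MvPolynomial (Fin d) k →ₐ[k] _) hmem
      rw [Ideal.map_span, ← Set.range_comp] at this
      convert this using 3
      funext j
      simp
    obtain ⟨i, hi⟩ := this
    refine ⟨{ toFun := fun p => co p i, map_zero' := ?_, map_add' := ?_ }, ⟨?_, ?_⟩, hi⟩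
    · exact congrFun ((co_zero 0).1 (zero_mem _)) i
    · exact fun p q => congrFun (co_add p q) i
    · exact fun p hp => congrFun ((co_zero p).1 hp) i
    · exact fun s p => congrFun (co_mul s p) i
  · by_contra! hm
    apply hp
    rw [co_zero]
    let M : Matrix β β (MvPolynomial (Fin d) k) := Matrix.of fun i j => Φ (b i * b j)
    refine Matrix.eq_zero_of_vecMul_eq_zero (M := M) ?_ ?_
    · intro hdet
      have hdet' : (M.map constantCoeff).det = 0 := by
        rw [← RingHom.mapMatrix_apply, ← RingHom.map_det, hdet, map_zero]
      obtain ⟨t, ht0, ht⟩ := Matrix.exists_vecMul_eq_zero_iff.2 hdet'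
      have hP : ∑ i, C (t i) * b i ∉ I ⊔ Ideal.span (Set.range f) := fun h => ht0 (hbi t h)
      obtain ⟨m, hm⟩ := hzm _ hP
      apply hΦz
      obtain ⟨u, hu⟩ := hbs m
      set P := ∑ i, C (t i) * b i with hPdef
      have h1 : constantCoeff (Φ z) = constantCoeff (Φ (P * ∑ j, C (u j) * b j)) := by
        rw [← sub_eq_zero, ← map_sub, ← map_sub]
        apply hΦ.constantCoeff_eq_zero
        have := sub_mem (Ideal.mul_mem_left _ P hu) hm
        convert this using 1
        ring
      rw [h1, Finset.mul_sum, map_sum, map_sum]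
      refine Finset.sum_eq_zero fun j _ => ?_
      have h2 : P * (C (u j) * b j) =
          ∑ i, aeval f (C (u j) * C (t i) : MvPolynomial (Fin d) k) * (b i * b j) := by
        rw [hPdef, Finset.sum_mul]
        refine Finset.sum_congr rfl fun i _ => ?_
        simp only [map_mul, aeval_C, algebraMap_eq]
        ring
      have h3 := congrFun ht j
      rw [h2, map_sum, map_sum]
      simp only [hΦ.2, map_mul, constantCoeff_C, mul_assoc]
      rw [← Finset.mul_sum]
      simp only [Matrix.vecMul, dotProduct, Matrix.map_apply, M, Matrix.of_apply,
        Pi.zero_apply] at h3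
      rw [h3, mul_zero]
    · funext j
      have h1 : Φ (p * b j) = Φ ((∑ i, aeval f (co p i) * b i) * b j) := by
        rw [← sub_eq_zero, ← map_sub, ← sub_mul]
        exact hΦ.1 _ (I.mul_mem_right _ (hco p))
      rw [hm, Finset.sum_mul, map_sum] at h1
      simp only [mul_assoc, hΦ.2] at h1
      exact h1.symm

end Pairing

section Restriction

variable {k : Type} [Field k] {n d : ℕ}

/-- The substitution `yⱼ ↦ fⱼ`, where `fⱼ` is the linear form with coefficients `c (j, ·)`. -/
def embLin (c : Fin d × Fin n → k) : MvPolynomial (Fin d) k →ₐ[k] MvPolynomial (Fin n) k :=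
  aeval fun j => linForm k fun i => c (j, i)

/-- The substitution of the restrictions of the linear forms `fⱼ` to the variables in `E`. -/
def resLin (c : Fin d × Fin n → k) (E : Finset (Fin n)) :
    MvPolynomial (Fin d) k →ₐ[k] MvPolynomial (Fin n) k :=
  aeval fun j => ∑ v ∈ E, C (c (j, v)) * X v

/-- The substitution killing the variables outside of `E`. -/
def killOutside (E : Finset (Fin n)) : MvPolynomial (Fin n) k →ₐ[k] MvPolynomial (Fin n) k :=
  aeval fun v => if v ∈ E then X v else 0

/-- The substitution of linear forms with coefficients `b v` for the variables in `W`, killing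
the other ones. -/
def retrLin (b : Fin n → Fin d → k) (W : Finset (Fin n)) :
    MvPolynomial (Fin n) k →ₐ[k] MvPolynomial (Fin d) k :=
  aeval fun v => if v ∈ W then ∑ j, C (b v j) * X j else 0

/-- The vectors `b v`, `v ∈ W`, are dual to the columns of `c` indexed by `W`. -/
structure DualBasis (c : Fin d × Fin n → k) (W : Finset (Fin n)) (b : Fin n → Fin d → k) :
    Prop where
  left : ∀ v ∈ W, ∀ w ∈ W, ∑ j, b v j * c (j, w) = if v = w then 1 else 0
  right : ∀ j j', ∑ v ∈ W, c (j, v) * b v j' = if j = j' then 1 else 0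

lemma DualBasis.retrLin_sum {c : Fin d × Fin n → k} {W : Finset (Fin n)} {b : Fin n → Fin d → k}
    (h : DualBasis c W b) (j : Fin d) :
    ∑ v ∈ W, C (c (j, v)) * ∑ j', C (b v j') * X j' = (X j : MvPolynomial (Fin d) k) := by
  simp only [Finset.mul_sum]
  rw [Finset.sum_comm]
  simp only [← mul_assoc, ← Finset.sum_mul, ← C_mul, ← map_sum, h.right]
  simp [apply_ite C, ite_mul]

lemma DualBasis.retrLin_embLin {c : Fin d × Fin n → k} {W : Finset (Fin n)}
    {b : Fin n → Fin d → k} (h : DualBasis c W b) (s : MvPolynomial (Fin d) k) :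
    retrLin b W (embLin c s) = s := by
  have : (retrLin b W).comp (embLin c) = AlgHom.id k _ := by
    ext1 j
    rw [AlgHom.comp_apply, embLin, aeval_X, linForm, map_sum, AlgHom.id_apply,
      ← h.retrLin_sum j, ← Finset.sum_subset (Finset.subset_univ W)]
    · refine Finset.sum_congr rfl fun v hv => ?_
      rw [map_mul, retrLin, aeval_X, if_pos hv, aeval_C, algebraMap_eq]
    · intro v _ hv
      rw [map_mul, retrLin, aeval_X, if_neg hv, mul_zero]
  exact DFunLike.congr_fun this s

lemma DualBasis.retrLin_resLin {c : Fin d × Fin n → k} {W : Finset (Fin n)}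
    {b : Fin n → Fin d → k} (h : DualBasis c W b) (s : MvPolynomial (Fin d) k) :
    retrLin b W (resLin c W s) = s := by
  have : (retrLin b W).comp (resLin c W) = AlgHom.id k _ := by
    ext1 j
    rw [AlgHom.comp_apply, resLin, aeval_X, map_sum, AlgHom.id_apply, ← h.retrLin_sum j]
    refine Finset.sum_congr rfl fun v hv => ?_
    rw [map_mul, retrLin, aeval_X, if_pos hv, aeval_C, algebraMap_eq]
  exact DFunLike.congr_fun this s

lemma resLin_sum (c : Fin d × Fin n → k) (E : Finset (Fin n)) (a : Fin d → k) :
    resLin c E (∑ j, C (a j) * X j) = ∑ w ∈ E, C (∑ j, a j * c (j, w)) * X w := by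
  simp only [map_sum, map_mul, Finset.sum_mul]
  rw [Finset.sum_comm]
  refine Finset.sum_congr rfl fun j _ => ?_
  rw [resLin, aeval_X, aeval_C, algebraMap_eq, Finset.mul_sum]
  refine Finset.sum_congr rfl fun w _ => ?_
  rw [mul_assoc]

lemma DualBasis.resLin_retrLin {c : Fin d × Fin n → k} {W : Finset (Fin n)}
    {b : Fin n → Fin d → k} (h : DualBasis c W b) {E : Finset (Fin n)} (hE : E ⊆ W)
    (p : MvPolynomial (Fin n) k) : resLin c E (retrLin b W p) = killOutside E p := by
  have : (resLin c E).comp (retrLin b W) = killOutside E := by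
    ext1 v
    rw [AlgHom.comp_apply, retrLin, aeval_X, killOutside, aeval_X]
    by_cases hv : v ∈ W
    · rw [if_pos hv, resLin_sum]
      have : ∀ w ∈ E, C (∑ j, b v j * c (j, w)) * X w =
          if v = w then (X w : MvPolynomial (Fin n) k) else 0 := fun w hw => by
        rw [h.left v hv w (hE hw)]
        split_ifs <;> simp
      rw [Finset.sum_congr rfl this, Finset.sum_ite_eq]
    · rw [if_neg hv, if_neg (fun h => hv (hE h)), map_zero]
  exact DFunLike.congr_fun this p

lemma killOutside_resLin (c : Fin d × Fin n → k) {E F : Finset (Fin n)} (hE : E ⊆ F)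
    (s : MvPolynomial (Fin d) k) : killOutside E (resLin c F s) = resLin c E s := by
  have : (killOutside E).comp (resLin c F) = resLin c E := by
    ext1 j
    rw [AlgHom.comp_apply, resLin, aeval_X, resLin, aeval_X, map_sum,
      ← Finset.sum_subset hE]
    · refine Finset.sum_congr rfl fun v hv => ?_
      rw [map_mul, killOutside, aeval_X, if_pos hv, aeval_C, algebraMap_eq]
    · intro v _ hv
      rw [map_mul, killOutside, aeval_X, if_neg hv, mul_zero]
  exact DFunLike.congr_fun this s

lemma killOutside_monomial (E : Finset (Fin n)) (m : Fin n →₀ ℕ) (a : k) :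
    killOutside E (monomial m a) = if m.support ⊆ E then monomial m a else 0 := by
  rw [killOutside, aeval_monomial, algebraMap_eq]
  split_ifs with h
  · rw [monomial_eq]
    congr 1
    exact Finset.prod_congr rfl fun v hv => by simp only [if_pos (h hv)]
  · obtain ⟨v, hv, hvE⟩ := Finset.not_subset.1 h
    rw [Finsupp.prod, Finset.prod_eq_zero hv, mul_zero]
    rw [if_neg hvE, zero_pow (Finsupp.mem_support_iff.1 hv)]

lemma coeff_killOutside (E : Finset (Fin n)) (p : MvPolynomial (Fin n) k) (m : Fin n →₀ ℕ) :
    coeff m (killOutside E p) = if m.support ⊆ E then coeff m p else 0 := by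
  classical
  induction p using MvPolynomial.induction_on' with
  | monomial u a =>
    rw [killOutside_monomial]
    by_cases hu : u = m
    · subst hu
      by_cases hE : u.support ⊆ E <;> simp [hE]
    · by_cases hE : u.support ⊆ E <;> simp [hE, coeff_monomial, hu]
  | add p q hp hq =>
    rw [map_add, coeff_add, coeff_add, hp, hq]
    split_ifs <;> simp

/-- The ideal generated by the variables outside of `E`. -/
def varsOutside (k : Type) [Field k] (E : Finset (Fin n)) : Ideal (MvPolynomial (Fin n) k) :=
  Ideal.span ((fun v => (X v : MvPolynomial (Fin n) k)) '' {v | v ∉ E})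

lemma X_mem_varsOutside {E : Finset (Fin n)} {v : Fin n} (hv : v ∉ E) :
    (X v : MvPolynomial (Fin n) k) ∈ varsOutside k E :=
  Ideal.subset_span ⟨v, hv, rfl⟩

lemma sub_killOutside_mem (E : Finset (Fin n)) (p : MvPolynomial (Fin n) k) :
    p - killOutside E p ∈ varsOutside k E := by
  have : (Ideal.Quotient.mkₐ k (varsOutside k E)).comp (killOutside E) =
      Ideal.Quotient.mkₐ k (varsOutside k E) := by
    ext1 v
    rw [AlgHom.comp_apply, killOutside, aeval_X]
    split_ifs with h
    · rfl
    · rw [map_zero]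
      exact (Ideal.Quotient.eq_zero_iff_mem.2 (X_mem_varsOutside h)).symm
  rw [← Ideal.Quotient.eq_zero_iff_mem, map_sub, sub_eq_zero]
  exact (DFunLike.congr_fun this p).symm

lemma embLin_sub_resLin_mem (c : Fin d × Fin n → k) (E : Finset (Fin n))
    (s : MvPolynomial (Fin d) k) : embLin c s - resLin c E s ∈ varsOutside k E := by
  have : (Ideal.Quotient.mkₐ k (varsOutside k E)).comp (embLin c) =
      (Ideal.Quotient.mkₐ k (varsOutside k E)).comp (resLin c E) := by
    ext1 j
    rw [AlgHom.comp_apply, AlgHom.comp_apply, ← sub_eq_zero, ← map_sub]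
    refine Ideal.Quotient.eq_zero_iff_mem.2 ?_
    rw [embLin, resLin, aeval_X, aeval_X, linForm,
      ← Finset.sum_sdiff (Finset.subset_univ E), add_sub_cancel_right]
    refine sum_mem fun v hv => Ideal.mul_mem_left _ _ (X_mem_varsOutside ?_)
    exact (Finset.mem_sdiff.1 hv).2
  rw [← Ideal.Quotient.eq_zero_iff_mem, map_sub, sub_eq_zero]
  exact DFunLike.congr_fun this s

lemma killOutside_xFace {E F : Finset (Fin n)} (h : F ⊆ E) :
    killOutside E (xFace k F) = xFace k F := by
  rw [xFace, map_prod]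
  exact Finset.prod_congr rfl fun v hv => by rw [killOutside, aeval_X, if_pos (h hv)]

lemma retrLin_xFace_eq_zero (b : Fin n → Fin d → k) {W F : Finset (Fin n)} (h : ¬ F ⊆ W) :
    retrLin b W (xFace k F) = 0 := by
  obtain ⟨v, hv, hvW⟩ := Finset.not_subset.1 h
  rw [xFace, map_prod, Finset.prod_eq_zero hv]
  rw [retrLin, aeval_X, if_neg hvW]

lemma xFace_ne_zero (F : Finset (Fin n)) : xFace k F ≠ 0 :=
  Finset.prod_ne_zero_iff.2 fun v _ => X_ne_zero v

lemma killOutside_eq_zero {D : SC n} {F : Finset (Fin n)} (hF : F ∈ D.faces)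
    {p : MvPolynomial (Fin n) k} (hp : p ∈ srIdeal k D) : killOutside F p = 0 := by
  have : srIdeal k D ≤ RingHom.ker (killOutside (k := k) F) := by
    refine Ideal.span_le.2 ?_
    rintro _ ⟨s, hs, rfl⟩
    obtain ⟨v, hv, hvF⟩ := Finset.not_subset.1 fun h => hs (D.down_closed F hF s h)
    show killOutside F _ = 0
    rw [map_prod, Finset.prod_eq_zero hv]
    rw [killOutside, aeval_X, if_neg hvF]
  exact this hp

lemma retrLin_killOutside (b : Fin n → Fin d → k) (W : Finset (Fin n))
    (p : MvPolynomial (Fin n) k) : retrLin b W (killOutside W p) = retrLin b W p := by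
  have : (retrLin b W).comp (killOutside W) = retrLin b W := by
    ext1 v
    rw [AlgHom.comp_apply, killOutside, aeval_X]
    split_ifs with h
    · rfl
    · rw [map_zero, retrLin, aeval_X, if_neg h]
  exact DFunLike.congr_fun this p

lemma retrLin_eq_zero (b : Fin n → Fin d → k) {D : SC n} {F : Finset (Fin n)} (hF : F ∈ D.faces)
    {p : MvPolynomial (Fin n) k} (hp : p ∈ srIdeal k D) : retrLin b F p = 0 := by
  rw [← retrLin_killOutside, killOutside_eq_zero hF hp, map_zero]

lemma xFace_notMem_srIdeal {D : SC n} {F : Finset (Fin n)} (hF : F ∈ D.faces) :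
    xFace k F ∉ srIdeal k D := fun h => by
  have := killOutside_eq_zero hF h
  rw [killOutside_xFace subset_rfl] at this
  exact xFace_ne_zero F this

/-- Membership in the Stanley–Reisner ideal is tested on faces. -/
lemma mem_srIdeal_of_killOutside {D : SC n} {p : MvPolynomial (Fin n) k}
    (h : ∀ τ ∈ D.faces, killOutside τ p = 0) : p ∈ srIdeal k D := by
  rw [p.as_sum]
  refine sum_mem fun m hm => ?_
  by_cases hmD : m.support ∈ D.faces
  · have := coeff_killOutside m.support p m
    rw [h _ hmD, if_pos subset_rfl, coeff_zero] at this
    exact absurd this.symm (mem_support_iff.1 hm)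
  · rw [monomial_eq]
    refine Ideal.mul_mem_left _ _ (Ideal.mem_of_dvd _ ?_ (Ideal.subset_span ⟨_, hmD, rfl⟩))
    exact Finset.prod_dvd_prod_of_dvd _ _ fun v hv =>
      dvd_pow_self _ (Finsupp.mem_support_iff.1 hv)

lemma xFace_mul_mem {D : SC n} {F : Finset (Fin n)}
    (hF : ∀ v, v ∉ F → insert v F ∉ D.faces) {p : MvPolynomial (Fin n) k}
    (hp : p ∈ varsOutside k F) : xFace k F * p ∈ srIdeal k D := by
  have : varsOutside k F ≤ Submodule.comap (LinearMap.mulLeft _ (xFace k F)) (srIdeal k D) := by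
    refine Ideal.span_le.2 ?_
    rintro _ ⟨v, hv, rfl⟩
    refine Ideal.subset_span ⟨_, hF v hv, ?_⟩
    rw [Finset.prod_insert hv, mul_comm]
    rfl
  exact this hp

/-- If a regular system of linear parameters exists, all facets have maximal dimension. -/
lemma exists_facet {D : SC n} (hdim : ∀ F ∈ D.faces, F.card ≤ d) (c : Fin d × Fin n → k)
    (htf : ∀ s, s ≠ 0 → ∀ p, embLin c s * p ∈ srIdeal k D → p ∈ srIdeal k D)
    {τ : Finset (Fin n)} (hτ : τ ∈ D.faces) :
    ∃ F ∈ D.faces, τ ⊆ F ∧ F.card = d := by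
  obtain ⟨F, hτF, hF⟩ := D.faces.exists_le_maximal hτ
  refine ⟨F, hF.prop, hτF, le_antisymm (hdim F hF.prop) ?_⟩
  by_contra! hlt
  have hmax : ∀ v, v ∉ F → insert v F ∉ D.faces := fun v hv h =>
    hv (hF.le_of_ge h (Finset.subset_insert v F) (Finset.mem_insert_self v F))
  let T : (Fin d → k) →ₗ[k] (F → k) :=
    { toFun := fun a v => ∑ j, a j * c (j, v)
      map_add' := by intro a b; funext v; simp [add_mul, Finset.sum_add_distrib]
      map_smul' := by intro r a; funext v; simp [Finset.mul_sum, mul_assoc] }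
  have hT : LinearMap.ker T ≠ ⊥ := LinearMap.ker_ne_bot_of_finrank_lt (by simpa using hlt)
  obtain ⟨a, ha, ha0⟩ := Submodule.exists_mem_ne_zero_of_ne_bot hT
  have hs0 : (∑ j, C (a j) * X j : MvPolynomial (Fin d) k) ≠ 0 := by
    intro h
    apply ha0
    funext j
    have := congrArg (eval (Pi.single j (1 : k))) h
    simpa [Pi.single_apply] using this
  refine xFace_notMem_srIdeal hF.prop (htf _ hs0 _ ?_)
  rw [mul_comm]
  apply xFace_mul_mem hmax
  have hres : resLin c F (∑ j, C (a j) * X j) = 0 := by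
    rw [resLin_sum]
    refine Finset.sum_eq_zero fun w hw => ?_
    have : T a ⟨w, hw⟩ = 0 := by rw [LinearMap.mem_ker.1 ha]; rfl
    rw [show ∑ j, a j * c (j, w) = 0 from this, C_0, zero_mul]
  have := embLin_sub_resLin_mem c F (∑ j, C (a j) * X j)
  rwa [hres, sub_zero] at this

end Restriction

section Ridges

variable {k : Type} [Field k] {n d : ℕ}

lemma dvd_of_forall_prime {S : Type} [CommRing S] [IsDomain S] [UniqueFactorizationMonoid S]
    {Q N : S} (hQ : Q ≠ 0) (h : ∀ π, Prime π → ∃ w, ¬ π ∣ w ∧ Q ∣ w * N) : Q ∣ N := by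
  obtain ⟨a, b, g, hab, rfl, rfl⟩ := UniqueFactorizationMonoid.exists_reduced_factors Q hQ N
  have hg : g ≠ 0 := left_ne_zero_of_mul hQ
  have ha : a ≠ 0 := right_ne_zero_of_mul hQ
  by_cases hu : IsUnit a
  · exact mul_dvd_mul_left g (hu.dvd)
  · exfalso
    obtain ⟨π, hπ, hπa⟩ := WfDvdMonoid.exists_irreducible_factor hu ha
    have hπ' := UniqueFactorizationMonoid.irreducible_iff_prime.1 hπ
    obtain ⟨w, hw, hdvd⟩ := h π hπ'
    rw [mul_left_comm, mul_dvd_mul_iff_left hg] at hdvd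
    exact hπ.not_isUnit (hab hπa ((hπ'.dvd_or_dvd (hπa.trans hdvd)).resolve_left hw))

lemma DualBasis.dvd_of_resLin_eq_zero {c : Fin d × Fin n → k} {F : Finset (Fin n)}
    {b : Fin n → Fin d → k} (h : DualBasis c F b) {j : Fin n}
    {s : MvPolynomial (Fin d) k} (hs : resLin c (F.erase j) s = 0) : retrLin b F (X j) ∣ s := by
  have h1 := sub_killOutside_mem (F.erase j) (resLin c F s)
  rw [killOutside_resLin c (Finset.erase_subset j F), hs, sub_zero] at h1
  have h2 : varsOutside k (F.erase j) ≤
      Ideal.comap (retrLin b F) (Ideal.span {retrLin b F (X j)}) := by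
    refine Ideal.span_le.2 ?_
    rintro _ ⟨v, hv, rfl⟩
    show retrLin b F (X v) ∈ Ideal.span {retrLin b F (X j)}
    by_cases hvj : v = j
    · rw [hvj]
      exact Ideal.mem_span_singleton_self _
    · have hvF : v ∉ F := fun hvF => hv (Finset.mem_erase.2 ⟨hvj, hvF⟩)
      have h0 : retrLin b F (X v) = 0 := by rw [retrLin, aeval_X, if_neg hvF]
      rw [h0]
      exact zero_mem _
  have h3 := h2 h1
  rw [Ideal.mem_comap, h.retrLin_resLin, Ideal.mem_span_singleton] at h3
  exact h3

lemma DualBasis.resLin_retrLin_X {c : Fin d × Fin n → k} {F : Finset (Fin n)}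
    {b : Fin n → Fin d → k} (h : DualBasis c F b) (j : Fin n) :
    resLin c (F.erase j) (retrLin b F (X j)) = 0 := by
  rw [h.resLin_retrLin (Finset.erase_subset j F), killOutside, aeval_X,
    if_neg (Finset.notMem_erase j F)]

lemma DualBasis.dvd_iff {c : Fin d × Fin n → k} {F : Finset (Fin n)}
    {b : Fin n → Fin d → k} (h : DualBasis c F b) (j : Fin n) (s : MvPolynomial (Fin d) k) :
    resLin c (F.erase j) s = 0 ↔ retrLin b F (X j) ∣ s := by
  refine ⟨h.dvd_of_resLin_eq_zero, ?_⟩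
  rintro ⟨t, rfl⟩
  rw [map_mul, h.resLin_retrLin_X, zero_mul]

lemma DualBasis.retrLin_ne_zero {c : Fin d × Fin n → k} {F E : Finset (Fin n)}
    {b : Fin n → Fin d → k} (h : DualBasis c F b) (hE : E ⊆ F) :
    retrLin b F (xFace k E) ≠ 0 := fun h0 => by
  have := h.resLin_retrLin subset_rfl (xFace k E)
  rw [h0, map_zero, killOutside_xFace hE] at this
  exact xFace_ne_zero E this.symm

/-- `ℓ` generates the kernel of the restriction to `E`, and it agrees up to the factor `κ F` with
the linear form dual to the vertex of `F` opposite to `E`. -/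
def IsRidge (c : Fin d × Fin n → k) (b : Finset (Fin n) → Fin n → Fin d → k)
    (E : Finset (Fin n)) (ℓ : MvPolynomial (Fin d) k) (κ : Finset (Fin n) → k) : Prop :=
  (∀ s, resLin c E s = 0 ↔ ℓ ∣ s) ∧ ∀ F, F.card = d → E ⊆ F → κ F ≠ 0 ∧
    retrLin (b F) F (xFace k F) = C (κ F) * ℓ * retrLin (b F) F (xFace k E)

lemma exists_isRidge {c : Fin d × Fin n → k} {b : Finset (Fin n) → Fin n → Fin d → k}
    (hb : ∀ W, W.card = d → DualBasis c W (b W)) {F : Finset (Fin n)} (hF : F.card = d)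
    {j : Fin n} (hj : j ∈ F) : ∃ ℓ κ, IsRidge c b (F.erase j) ℓ κ ∧ retrLin (b F) F (X j) ∣ ℓ := by
  have key : ∀ G : Finset (Fin n), ∃ a : k, G.card = d → F.erase j ⊆ G → a ≠ 0 ∧
      retrLin (b G) G (xFace k G) =
        C a * retrLin (b F) F (X j) * retrLin (b G) G (xFace k (F.erase j)) := by
    intro G
    by_cases hG : G.card = d ∧ F.erase j ⊆ G
    · obtain ⟨i, hi, rfl⟩ := Finset.exists_eq_insert_iff.2
        ⟨hG.2, by rw [Finset.card_erase_add_one hj, hF, hG.1]⟩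
      set G := insert i (F.erase j) with hGdef
      have hE : G.erase i = F.erase j := Finset.erase_insert hi
      have hass : Associated (retrLin (b F) F (X j)) (retrLin (b G) G (X i)) := by
        refine associated_of_dvd_dvd ?_ ?_
        · rw [← (hb F hF).dvd_iff, ← hE, (hb G hG.1).dvd_iff]
        · rw [← (hb G hG.1).dvd_iff, hE, (hb F hF).dvd_iff]
      obtain ⟨u, hu⟩ := hass
      obtain ⟨h1, h2⟩ := MvPolynomial.isUnit_iff_totalDegree_of_isReduced.1 u.isUnit
      rw [totalDegree_eq_zero_iff_eq_C] at h2
      refine ⟨coeff 0 (u : MvPolynomial (Fin d) k), fun _ _ => ⟨h1.ne_zero, ?_⟩⟩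
      rw [← h2, mul_comm (u : MvPolynomial (Fin d) k), hu, ← map_mul, xFace, xFace, hGdef,
        Finset.prod_insert hi]
    · exact ⟨0, fun h1 h2 => absurd ⟨h1, h2⟩ hG⟩
  choose κ hκ using key
  exact ⟨_, κ, ⟨(hb F hF).dvd_iff j, hκ⟩, dvd_rfl⟩

/-- The product over all facets but `F` of the images of the facet monomials. -/
def cofactor (b : Finset (Fin n) → Fin n → Fin d → k) (A : Finset (Finset (Fin n)))
    (F : Finset (Fin n)) : MvPolynomial (Fin d) k :=
  ∏ G ∈ A.erase F, retrLin (b G) G (xFace k G)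

/-- The product over all facets of the images of the facet monomials. -/
def denom (b : Finset (Fin n) → Fin n → Fin d → k) (A : Finset (Finset (Fin n))) :
    MvPolynomial (Fin d) k :=
  ∏ G ∈ A, retrLin (b G) G (xFace k G)

/-- The numerator of the functional taking the value `u F` on the facet monomial `x_F`. -/
def numer (b : Finset (Fin n) → Fin n → Fin d → k) (A : Finset (Finset (Fin n)))
    (u : Finset (Fin n) → MvPolynomial (Fin d) k) (p : MvPolynomial (Fin n) k) :
    MvPolynomial (Fin d) k :=
  ∑ F ∈ A, u F * retrLin (b F) F p * cofactor b A F

/-- The linear relations among the values `u F` coming from ridges. -/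
def RidgeRel (c : Fin d × Fin n → k) (b : Finset (Fin n) → Fin n → Fin d → k)
    (A : Finset (Finset (Fin n))) (u : Finset (Fin n) → MvPolynomial (Fin d) k) : Prop :=
  ∀ E ℓ κ, IsRidge c b E ℓ κ → ℓ ≠ 0 →
    resLin c E (∑ F ∈ A with E ⊆ F, C (κ F)⁻¹ * u F) = 0

variable {c : Fin d × Fin n → k} {b : Finset (Fin n) → Fin n → Fin d → k}
  {A : Finset (Finset (Fin n))}

lemma mul_cofactor {F : Finset (Fin n)} (hF : F ∈ A) :
    retrLin (b F) F (xFace k F) * cofactor b A F = denom b A :=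
  Finset.mul_prod_erase A (fun G => retrLin (b G) G (xFace k G)) hF

lemma denom_ne_zero (hb : ∀ W, W.card = d → DualBasis c W (b W)) (hA : ∀ F ∈ A, F.card = d) :
    denom b A ≠ 0 :=
  Finset.prod_ne_zero_iff.2 fun F hF => (hb F (hA F hF)).retrLin_ne_zero subset_rfl

lemma numer_xFace (hA : ∀ F ∈ A, F.card = d) (u : Finset (Fin n) → MvPolynomial (Fin d) k)
    {F : Finset (Fin n)} (hF : F ∈ A) (m : MvPolynomial (Fin n) k) :
    numer b A u (xFace k F * m) = denom b A * (u F * retrLin (b F) F m) := by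
  rw [numer, Finset.sum_eq_single F, ← mul_cofactor hF, map_mul]
  · ring
  · intro G hG hGF
    rw [map_mul, retrLin_xFace_eq_zero, zero_mul, mul_zero, zero_mul]
    intro h
    exact hGF (Finset.eq_of_subset_of_card_le h (by rw [hA G hG, hA F hF])).symm
  · exact fun h => absurd hF h

lemma numer_embLin (hb : ∀ W, W.card = d → DualBasis c W (b W)) (hA : ∀ F ∈ A, F.card = d)
    (u : Finset (Fin n) → MvPolynomial (Fin d) k) (s : MvPolynomial (Fin d) k)
    (p : MvPolynomial (Fin n) k) : numer b A u (embLin c s * p) = s * numer b A u p := by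
  rw [numer, numer, Finset.mul_sum]
  refine Finset.sum_congr rfl fun F hF => ?_
  rw [map_mul, (hb F (hA F hF)).retrLin_embLin]
  ring

lemma numer_add (u : Finset (Fin n) → MvPolynomial (Fin d) k) (p q : MvPolynomial (Fin n) k) :
    numer b A u (p + q) = numer b A u p + numer b A u q := by
  simp only [numer, map_add, mul_add, add_mul, Finset.sum_add_distrib]

/-- Functionals are determined by their values on facet monomials. -/
lemma denom_mul_eq_numer {D : SC n} (hb : ∀ W, W.card = d → DualBasis c W (b W))
    (hA : ∀ F, F ∈ A ↔ F ∈ D.faces ∧ F.card = d)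
    (hpure : ∀ τ ∈ D.faces, ∃ F ∈ A, τ ⊆ F)
    {Φ : MvPolynomial (Fin n) k →+ MvPolynomial (Fin d) k}
    (hΦ : IsFunctional (srIdeal k D) (fun j => linForm k fun i => c (j, i)) Φ)
    (p : MvPolynomial (Fin n) k) :
    denom b A * Φ p = numer b A (fun F => Φ (xFace k F)) p := by
  have hA' : ∀ F ∈ A, F.card = d := fun F hF => ((hA F).1 hF).2
  have hmem : embLin c (denom b A) * p -
      ∑ F ∈ A, embLin c (cofactor b A F * retrLin (b F) F p) * xFace k F ∈ srIdeal k D := by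
    apply mem_srIdeal_of_killOutside
    intro τ hτ
    obtain ⟨G, hG, hτG⟩ := hpure τ hτ
    rw [← (hb G (hA' G hG)).resLin_retrLin hτG]
    convert map_zero (resLin c τ)
    rw [map_sub, map_mul, map_sum, (hb G (hA' G hG)).retrLin_embLin,
      Finset.sum_eq_single G, map_mul, (hb G (hA' G hG)).retrLin_embLin, ← mul_cofactor hG]
    · ring
    · intro F hF hFG
      rw [map_mul, retrLin_xFace_eq_zero, mul_zero]
      intro h
      exact hFG (Finset.eq_of_subset_of_card_le h (by rw [hA' G hG, hA' F hF]))
    · exact fun h => absurd hG h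
  have h := hΦ.1 _ hmem
  have hΦ2 : ∀ s p, Φ (embLin c s * p) = s * Φ p := hΦ.2
  rw [map_sub, map_sum, sub_eq_zero, hΦ2] at h
  rw [h, numer]
  refine Finset.sum_congr rfl fun F _ => ?_
  rw [hΦ2]
  ring

lemma ridgeRel_of_isFunctional {D : SC n} (hb : ∀ W, W.card = d → DualBasis c W (b W))
    (hA : ∀ F, F ∈ A ↔ F ∈ D.faces ∧ F.card = d)
    (hpure : ∀ τ ∈ D.faces, ∃ F ∈ A, τ ⊆ F)
    {Φ : MvPolynomial (Fin n) k →+ MvPolynomial (Fin d) k}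
    (hΦ : IsFunctional (srIdeal k D) (fun j => linForm k fun i => c (j, i)) Φ) :
    RidgeRel c b A fun F => Φ (xFace k F) := by
  intro E ℓ κ hE hℓ
  have hA' : ∀ F ∈ A, F.card = d := fun F hF => ((hA F).1 hF).2
  have h := denom_mul_eq_numer hb hA hpure hΦ (xFace k E)
  rw [hE.1]
  refine ⟨Φ (xFace k E), mul_left_cancel₀ (denom_ne_zero hb hA') ?_⟩
  rw [mul_left_comm, h, numer, ← Finset.sum_filter_add_sum_filter_not A (fun F => E ⊆ F),
    Finset.sum_eq_zero (s := A.filter fun F => ¬ E ⊆ F), add_zero, Finset.mul_sum, Finset.mul_sum]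
  · refine Finset.sum_congr rfl fun F hF => ?_
    obtain ⟨hF, hEF⟩ := Finset.mem_filter.1 hF
    obtain ⟨hκ, hL⟩ := hE.2 F (hA' F hF) hEF
    rw [← mul_cofactor hF, hL]
    have : C (κ F) * C (κ F)⁻¹ = (1 : MvPolynomial (Fin d) k) := by
      rw [← C_mul, mul_inv_cancel₀ hκ, C_1]
    linear_combination (ℓ * retrLin (b F) F (xFace k E) * cofactor b A F * Φ (xFace k F)) * this
  · intro F hF
    rw [retrLin_xFace_eq_zero _ (Finset.mem_filter.1 hF).2, mul_zero, zero_mul]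

/-- The part of the family `u` supported on the monomial with exponent `a`. -/
def monomialPart (c : Fin d × Fin n → k) (b : Finset (Fin n) → Fin n → Fin d → k)
    (u : Finset (Fin n) → MvPolynomial (Fin d) k) (a : Fin n →₀ ℕ) (F : Finset (Fin n)) :
    MvPolynomial (Fin d) k :=
  C (coeff a (resLin c F (u F))) * retrLin (b F) F (monomial a 1)

lemma RidgeRel.monomialPart (hb : ∀ W, W.card = d → DualBasis c W (b W))
    (hA : ∀ F ∈ A, F.card = d) {u : Finset (Fin n) → MvPolynomial (Fin d) k}
    (hu : RidgeRel c b A u) (a : Fin n →₀ ℕ) : RidgeRel c b A (monomialPart c b u a) := by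
  intro E ℓ κ hE hℓ
  have h := hu E ℓ κ hE hℓ
  rw [map_sum] at h ⊢
  have h1 : ∀ F ∈ A.filter (fun F => E ⊆ F),
      resLin c E (C (κ F)⁻¹ * SRWLP.monomialPart c b u a F) =
        C ((κ F)⁻¹ * coeff a (resLin c F (u F))) * killOutside E (monomial a 1) := by
    intro F hF
    obtain ⟨hF, hEF⟩ := Finset.mem_filter.1 hF
    rw [SRWLP.monomialPart, map_mul, map_mul, (hb F (hA F hF)).resLin_retrLin hEF, C_mul,
      mul_assoc, ← algebraMap_eq, AlgHom.commutes, AlgHom.commutes]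
    rfl
  rw [Finset.sum_congr rfl h1, ← Finset.sum_mul, ← map_sum, killOutside_monomial]
  split_ifs with ha
  · have h2 := congrArg (coeff a) h
    rw [coeff_sum, coeff_zero] at h2
    have h3 : ∑ F ∈ A with E ⊆ F, (κ F)⁻¹ * coeff a (resLin c F (u F)) = 0 := by
      rw [← h2]
      refine Finset.sum_congr rfl fun F hF => ?_
      obtain ⟨hF, hEF⟩ := Finset.mem_filter.1 hF
      rw [map_mul, ← algebraMap_eq, AlgHom.commutes, algebraMap_eq, coeff_C_mul,
        ← killOutside_resLin c hEF, coeff_killOutside, if_pos ha]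
    rw [h3, C_0, zero_mul]
  · rw [mul_zero]

lemma sum_monomialPart (hb : ∀ W, W.card = d → DualBasis c W (b W))
    {u : Finset (Fin n) → MvPolynomial (Fin d) k} {F : Finset (Fin n)} (hF : F.card = d)
    {S : Finset (Fin n →₀ ℕ)} (hS : (resLin c F (u F)).support ⊆ S) :
    ∑ a ∈ S, monomialPart c b u a F = u F := by
  conv_rhs => rw [← (hb F hF).retrLin_resLin (u F), (resLin c F (u F)).as_sum, map_sum]
  rw [Finset.sum_subset hS]
  · refine Finset.sum_congr rfl fun a _ => ?_
    rw [monomialPart, ← algebraMap_eq, ← AlgHom.commutes (retrLin (b F) F), ← map_mul,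
      algebraMap_eq, C_mul_monomial, mul_one]
  · intro a _ ha
    rw [notMem_support_iff.1 ha, monomial_zero, map_zero]

lemma resLin_retrLin_X_ne_zero (hb : ∀ W, W.card = d → DualBasis c W (b W))
    {E F : Finset (Fin n)} (hE : E.card + 1 = d) (hF : F.card = d) (hEF : ¬ E ⊆ F)
    {v : Fin n} (hv : v ∈ F) : resLin c E (retrLin (b F) F (X v)) ≠ 0 := by
  intro h0
  rw [retrLin, aeval_X, if_pos hv, resLin_sum] at h0
  have h1 : ∀ w ∈ E, ∑ j, b F v j * c (j, w) = 0 := by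
    intro w hw
    have := congrArg (eval (Pi.single w (1 : k))) h0
    simpa [Pi.single_apply, hw] using this
  obtain ⟨w, hw, hwE⟩ : ∃ w ∈ F.erase v, w ∉ E := by
    by_contra! h
    have hEq : F.erase v = E := Finset.eq_of_subset_of_card_le h (by
      rw [Finset.card_erase_of_mem hv]; omega)
    exact hEF (hEq ▸ Finset.erase_subset v F)
  have hW := hb (insert w E) (by rw [Finset.card_insert_of_notMem hwE, hE])
  obtain ⟨hwv, hwF⟩ := Finset.mem_erase.1 hw
  have h2 : ∀ x ∈ insert w E, ∑ j, b F v j * c (j, x) = 0 := by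
    intro x hx
    rcases Finset.mem_insert.1 hx with rfl | hx
    · rw [(hb F hF).left v hv x hwF, if_neg (Ne.symm hwv)]
    · exact h1 x hx
  have h3 : ∀ j', b F v j' = 0 := by
    intro j'
    have : ∑ x ∈ insert w E, (∑ j, b F v j * c (j, x)) * b (insert w E) x j' = b F v j' := by
      simp only [Finset.sum_mul, mul_assoc]
      rw [Finset.sum_comm]
      simp only [← Finset.mul_sum, hW.right]
      simp
    rw [← this]
    exact Finset.sum_eq_zero fun x hx => by rw [h2 x hx, zero_mul]
  have h4 := (hb F hF).left v hv v hv
  rw [if_pos rfl] at h4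
  simp [h3] at h4

/-- The numerators of families satisfying the ridge relations are divisible by the common
denominator. -/
lemma RidgeRel.denom_dvd_numer (hb : ∀ W, W.card = d → DualBasis c W (b W))
    (hA : ∀ F ∈ A, F.card = d) {u : Finset (Fin n) → MvPolynomial (Fin d) k}
    (hu : RidgeRel c b A u) (p : MvPolynomial (Fin n) k) : denom b A ∣ numer b A u p := by
  classical
  refine dvd_of_forall_prime (denom_ne_zero hb hA) fun π hπ => ?_
  by_cases hπd : π ∣ denom b A
  swap
  · exact ⟨_, hπd, dvd_mul_right _ _⟩
  obtain ⟨F₀, hF₀, hπF⟩ := (hπ.dvd_finsetProd_iff _).1 hπd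
  rw [xFace, map_prod] at hπF
  obtain ⟨j₀, hj₀, hπj⟩ := (hπ.dvd_finsetProd_iff _).1 hπF
  have hF₀d := hA F₀ hF₀
  set E := F₀.erase j₀ with hEdef
  have hEcard : E.card + 1 = d := by rw [hEdef, Finset.card_erase_add_one hj₀, hF₀d]
  obtain ⟨ℓ, κ, hE, hℓ⟩ := exists_isRidge hb hF₀d hj₀
  have hℓ0 : ℓ ≠ 0 := by
    rintro rfl
    have := (hE.2 F₀ hF₀d (Finset.erase_subset _ _)).2
    rw [mul_zero, zero_mul] at this
    exact (hb F₀ hF₀d).retrLin_ne_zero subset_rfl this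
  have hℓp : Prime ℓ := by
    refine ⟨hℓ0, fun hun => ?_, fun x y hxy => ?_⟩
    · have := (hE.1 1).2 hun.dvd
      rw [map_one] at this
      exact one_ne_zero this
    · rw [← hE.1, ← hE.1, ← mul_eq_zero, ← map_mul, hE.1]
      exact hxy
  have hℓπ : ℓ ∣ π := ((hπ.associated_of_dvd hℓp (hπj.trans hℓ)).symm).dvd
  set w₁ := ∏ F ∈ A with ¬ E ⊆ F, retrLin (b F) F (xFace k F) with hw₁
  set w₂ := ∏ F ∈ A with E ⊆ F, retrLin (b F) F (xFace k E) with hw₂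
  refine ⟨w₁ * w₂, fun h => ?_, ?_⟩
  · have h1 := (hE.1 _).2 (hℓπ.trans h)
    rw [map_mul, mul_eq_zero, hw₁, hw₂, map_prod, map_prod, Finset.prod_eq_zero_iff,
      Finset.prod_eq_zero_iff] at h1
    rcases h1 with ⟨F, hF, h1⟩ | ⟨F, hF, h1⟩
    · obtain ⟨hF, hEF⟩ := Finset.mem_filter.1 hF
      rw [xFace, map_prod, map_prod, Finset.prod_eq_zero_iff] at h1
      obtain ⟨v, hv, h1⟩ := h1
      exact resLin_retrLin_X_ne_zero hb hEcard (hA F hF) hEF hv h1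
    · obtain ⟨hF, hEF⟩ := Finset.mem_filter.1 hF
      rw [(hb F (hA F hF)).resLin_retrLin hEF, killOutside_xFace subset_rfl] at h1
      exact xFace_ne_zero E h1
  · rw [numer, ← Finset.sum_filter_add_sum_filter_not A (fun F => E ⊆ F), mul_add]
    refine dvd_add ?_ ?_
    · rw [mul_assoc]
      refine Dvd.dvd.mul_left ?_ _
      let cof : Finset (Fin n) → MvPolynomial (Fin d) k := fun F =>
        ∏ G ∈ (A.filter fun F => E ⊆ F).erase F, retrLin (b G) G (xFace k E)
      have hX : ℓ * (w₂ * ∑ F ∈ A with E ⊆ F, u F * retrLin (b F) F p * cofactor b A F) =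
          denom b A * ∑ F ∈ A with E ⊆ F, C (κ F)⁻¹ * u F * retrLin (b F) F p * cof F := by
        simp only [Finset.mul_sum]
        refine Finset.sum_congr rfl fun F hF => ?_
        have h2 : retrLin (b F) F (xFace k E) * cof F = w₂ :=
          Finset.mul_prod_erase _ (fun G => retrLin (b G) G (xFace k E)) hF
        obtain ⟨hF, hEF⟩ := Finset.mem_filter.1 hF
        obtain ⟨hκ, hL⟩ := hE.2 F (hA F hF) hEF
        rw [← mul_cofactor hF, hL, ← h2]
        have : C (κ F) * C (κ F)⁻¹ = (1 : MvPolynomial (Fin d) k) := by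
          rw [← C_mul, mul_inv_cancel₀ hκ, C_1]
        linear_combination -(ℓ * retrLin (b F) F (xFace k E) * cofactor b A F * u F *
          retrLin (b F) F p * cof F) * this
      have hX0 : resLin c E
          (∑ F ∈ A with E ⊆ F, C (κ F)⁻¹ * u F * retrLin (b F) F p * cof F) = 0 := by
        have h3 : ∀ F ∈ A.filter (fun F => E ⊆ F),
            resLin c E (C (κ F)⁻¹ * u F * retrLin (b F) F p * cof F) =
              resLin c E (C (κ F)⁻¹ * u F) * (killOutside E p *
                xFace k E ^ ((A.filter fun F => E ⊆ F).card - 1)) := by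
          intro F hF
          have h4 : resLin c E (cof F) =
              xFace k E ^ ((A.filter fun F => E ⊆ F).card - 1) := by
            rw [map_prod, Finset.prod_congr rfl (g := fun _ => xFace k E), Finset.prod_const,
              Finset.card_erase_of_mem hF]
            intro G hG
            obtain ⟨hG, hEG⟩ := Finset.mem_filter.1 (Finset.mem_erase.1 hG).2
            rw [(hb G (hA G hG)).resLin_retrLin hEG, killOutside_xFace subset_rfl]
          obtain ⟨hF, hEF⟩ := Finset.mem_filter.1 hF
          rw [map_mul _ _ (cof F), map_mul _ _ (retrLin (b F) F p), h4,
            (hb F (hA F hF)).resLin_retrLin hEF, mul_assoc]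
        rw [map_sum, Finset.sum_congr rfl h3, ← Finset.sum_mul, ← map_sum, hu E ℓ κ hE hℓ0,
          zero_mul]
      obtain ⟨Y, hY⟩ := (hE.1 _).1 hX0
      rw [hY, mul_left_comm (denom b A)] at hX
      exact ⟨Y, mul_left_cancel₀ hℓ0 hX⟩
    · rw [Finset.mul_sum]
      refine Finset.dvd_sum fun F hF => ?_
      have h5 : retrLin (b F) F (xFace k F) ∣ w₁ :=
        Finset.dvd_prod_of_mem (fun G => retrLin (b G) G (xFace k G)) hF
      obtain ⟨hF, -⟩ := Finset.mem_filter.1 hF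
      rw [← mul_cofactor hF]
      obtain ⟨t, ht⟩ := h5
      rw [ht]
      exact ⟨t * w₂ * u F * retrLin (b F) F p, by ring⟩

end Ridges

section FacetMonomials

variable {k : Type} [Field k] {n d : ℕ} {c : Fin d × Fin n → k}
  {b : Finset (Fin n) → Fin n → Fin d → k} {A : Finset (Finset (Fin n))} {D : SC n}

lemma RidgeRel.exists_isFunctional (hb : ∀ W, W.card = d → DualBasis c W (b W))
    (hA : ∀ F, F ∈ A ↔ F ∈ D.faces ∧ F.card = d)
    {u : Finset (Fin n) → MvPolynomial (Fin d) k} (hu : RidgeRel c b A u) :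
    ∃ Ψ, IsFunctional (srIdeal k D) (fun j => linForm k fun i => c (j, i)) Ψ ∧
      ∀ p, denom b A * Ψ p = numer b A u p := by
  have hA' : ∀ F ∈ A, F.card = d := fun F hF => ((hA F).1 hF).2
  have h0 := denom_ne_zero hb hA'
  choose Y hY using fun p => hu.denom_dvd_numer hb hA' p
  refine ⟨AddMonoidHom.mk' Y fun p q => mul_left_cancel₀ h0 ?_, ⟨fun p hp => ?_, fun s p => ?_⟩,
    fun p => (hY p).symm⟩
  · rw [mul_add, ← hY, ← hY, ← hY, numer_add]
  · refine mul_left_cancel₀ h0 ?_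
    rw [AddMonoidHom.mk'_apply, ← hY, mul_zero, numer]
    exact Finset.sum_eq_zero fun F hF => by
      rw [retrLin_eq_zero _ ((hA F).1 hF).1 hp, mul_zero, zero_mul]
  · refine mul_left_cancel₀ h0 ?_
    rw [AddMonoidHom.mk'_apply, ← hY, mul_left_comm, ← hY]
    exact numer_embLin hb hA' u s p

/-- In an Artinian reduction of a Gorenstein* complex by linear forms in general position, the
facet monomials do not vanish. -/
theorem xFace_notMem_redIdeal
    (hreg : RegSeq (srIdeal k D) (List.ofFn fun j => linForm k fun i => c (j, i)))
    (hart : artGor k (redIdeal k (srIdeal k D) c))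
    (hdual : ∀ W : Finset (Fin n), W.card = d → ∃ b, DualBasis c W b)
    (hdim : ∀ F ∈ D.faces, F.card ≤ d)
    (hcone : ∀ i, ∃ τ ∈ D.faces, insert i τ ∉ D.faces) :
    (∀ τ ∈ D.faces, ∃ F ∈ D.faces, τ ⊆ F ∧ F.card = d) ∧
      ∀ F ∈ D.faces, F.card = d → xFace k F ∉ redIdeal k (srIdeal k D) c := by
  classical
  choose! b hb using hdual
  obtain ⟨htf, z, ⟨Φ, hΦ, hΦz⟩, hnd⟩ :=
    exists_isFunctional (homIdeal_srIdeal D) (fun j => isHomogeneous_linForm _) hreg hart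
  have hfacet : ∀ τ ∈ D.faces, ∃ F ∈ D.faces, τ ⊆ F ∧ F.card = d := fun τ hτ =>
    exists_facet hdim c htf hτ
  refine ⟨hfacet, ?_⟩
  set A := D.faces.filter fun F => F.card = d with hAdef
  have hA : ∀ F, F ∈ A ↔ F ∈ D.faces ∧ F.card = d := fun F => Finset.mem_filter
  have hA' : ∀ F ∈ A, F.card = d := fun F hF => ((hA F).1 hF).2
  have h0 := denom_ne_zero hb hA'
  have hpure : ∀ τ ∈ D.faces, ∃ F ∈ A, τ ⊆ F := fun τ hτ => by
    obtain ⟨F, hF, hτF, hFd⟩ := hfacet τ hτ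
    exact ⟨F, (hA F).2 ⟨hF, hFd⟩, hτF⟩
  set u : Finset (Fin n) → MvPolynomial (Fin d) k := fun F => Φ (xFace k F) with hu
  have hrel : RidgeRel c b A u := ridgeRel_of_isFunctional hb hA hpure hΦ
  choose Ψ hΨ hΨn using fun a => (hrel.monomialPart hb hA' a).exists_isFunctional hb hA
  set S := A.biUnion fun F => (resLin c F (u F)).support with hS
  have hsum : ∑ a ∈ S, Ψ a z = Φ z := by
    refine mul_left_cancel₀ h0 ?_
    rw [Finset.mul_sum, denom_mul_eq_numer hb hA hpure hΦ z]
    simp only [hΨn, numer]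
    rw [Finset.sum_comm]
    refine Finset.sum_congr rfl fun F hF => ?_
    rw [← Finset.sum_mul, ← Finset.sum_mul, sum_monomialPart hb (hA' F hF)]
    exact Finset.subset_biUnion_of_mem (fun F => (resLin c F (u F)).support) hF
  obtain ⟨a, -, ha⟩ : ∃ a ∈ S, constantCoeff (Ψ a z) ≠ 0 := by
    by_contra! h
    apply hΦz
    rw [← hsum, map_sum]
    exact Finset.sum_eq_zero h
  have hne : ∀ F ∈ A, monomialPart c b u a F ≠ 0 := by
    intro F hF hzero
    obtain ⟨m, hm⟩ := hnd (Ψ a) (hΨ a) ha _ (xFace_notMem_srIdeal ((hA F).1 hF).1)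
    have := hΨn a (xFace k F * m)
    rw [numer_xFace hA' _ hF, hzero, zero_mul, mul_zero, mul_eq_zero] at this
    exact this.elim h0 hm
  have hsupp : ∀ F ∈ A, a.support ⊆ F := by
    intro F hF
    by_contra hsub
    apply hne F hF
    rw [monomialPart, (by
      rw [← retrLin_killOutside, killOutside_monomial, if_neg hsub, map_zero] :
        retrLin (b F) F (monomial a (1 : k)) = 0), mul_zero]
  have ha0 : a = 0 := by
    by_contra hne0
    obtain ⟨v, hv⟩ := Finsupp.support_nonempty_iff.2 hne0
    obtain ⟨τ, hτ, hvτ⟩ := hcone v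
    obtain ⟨F, hF, hτF⟩ := hpure τ hτ
    exact hvτ (D.down_closed F ((hA F).1 hF).1 _
      (Finset.insert_subset (hsupp F hF hv) hτF))
  intro F hF hFd hmem
  have hFA : F ∈ A := (hA F).2 ⟨hF, hFd⟩
  have h1 : Ψ a (xFace k F) = monomialPart c b u a F := by
    refine mul_left_cancel₀ h0 ?_
    have := numer_xFace (b := b) hA' (monomialPart c b u a) hFA 1
    rw [mul_one, map_one, mul_one] at this
    rw [hΨn, this]
  have h2 := (hΨ a).constantCoeff_eq_zero hmem
  apply hne F hFA
  rw [h1, monomialPart, ha0, ← C_apply, C_1, map_one, mul_one, constantCoeff_C] at h2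
  rw [monomialPart, ha0, h2, C_0, zero_mul]

end FacetMonomials

section Genericity

variable {k : Type} [Field k] {n d : ℕ}

lemma exists_minors (d n : ℕ) : ∃ g : MvPolynomial (Fin d × Fin n) k, g ≠ 0 ∧
    ∀ c, eval c g ≠ 0 → ∀ W : Finset (Fin n), W.card = d → ∃ b, DualBasis c W b := by
  classical
  have key : ∀ W : Finset (Fin n), ∃ g : MvPolynomial (Fin d × Fin n) k, g ≠ 0 ∧
      ∀ c, eval c g ≠ 0 → W.card = d → ∃ b, DualBasis c W b := by
    intro W
    by_cases hW : W.card = d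
    swap
    · exact ⟨1, one_ne_zero, fun _ _ h => absurd h hW⟩
    set e := W.orderEmbOfFin hW with he
    have hev : ∀ c : Fin d × Fin n → k,
        eval c (Matrix.det (Matrix.of fun j i => (X (j, e i) : MvPolynomial (Fin d × Fin n) k))) =
          Matrix.det (Matrix.of fun j i => c (j, e i)) := by
      intro c
      rw [RingHom.map_det]
      congr 1
      ext j i
      simp
    refine ⟨Matrix.det (Matrix.of fun j i => X (j, e i)), fun h0 => ?_, fun c hc _ => ?_⟩
    · have h1 := hev fun x => if x.2 = e x.1 then 1 else 0
      rw [h0, map_zero] at h1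
      have h2 : (Matrix.of fun j i : Fin d => if e i = e j then (1 : k) else 0) = 1 := by
        ext j i
        simp [Matrix.one_apply, eq_comm]
      rw [h2, Matrix.det_one] at h1
      exact zero_ne_one h1
    · rw [hev] at hc
      set M : Matrix (Fin d) (Fin d) k := Matrix.of fun j i => c (j, e i) with hM
      have hWe : W = Finset.univ.map e.toEmbedding := (Finset.map_orderEmbOfFin_univ W hW).symm
      have hb : ∀ i j, ∑ i', (if e i' = e i then M⁻¹ i' j else 0) = M⁻¹ i j := by
        intro i j
        simp
      refine ⟨fun v j => ∑ i, if e i = v then M⁻¹ i j else 0, fun v hv w hw => ?_, fun j j' => ?_⟩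
      · rw [hWe] at hv hw
        obtain ⟨i, -, rfl⟩ := Finset.mem_map.1 hv
        obtain ⟨i', -, rfl⟩ := Finset.mem_map.1 hw
        have h1 := congrFun (congrFun (Matrix.nonsing_inv_mul M (isUnit_iff_ne_zero.2 hc)) i) i'
        rw [Matrix.mul_apply, Matrix.one_apply] at h1
        simp only [RelEmbedding.coe_toEmbedding, EmbeddingLike.apply_eq_iff_eq,
          Finset.sum_ite_eq', Finset.mem_univ, if_true]
        exact h1
      · have h1 := congrFun (congrFun (Matrix.mul_nonsing_inv M (isUnit_iff_ne_zero.2 hc)) j) j'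
        rw [Matrix.mul_apply, Matrix.one_apply] at h1
        conv_lhs => rw [hWe, Finset.sum_map]
        simp only [RelEmbedding.coe_toEmbedding, hb]
        exact h1
  choose g hg hgc using key
  refine ⟨∏ W, g W, Finset.prod_ne_zero_iff.2 fun W _ => hg W, fun c hc W hW => hgc W c ?_ hW⟩
  rw [map_prod, Finset.prod_ne_zero_iff] at hc
  exact hc W (Finset.mem_univ W)

lemma exists_regSeq_of_depthGE {J : Ideal (MvPolynomial (Fin n) k)} {t : ℕ}
    (h : depthGE k J t) : ∃ rs : List (MvPolynomial (Fin n) k), rs.length = t ∧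
      (∀ r ∈ rs, r ∈ Ideal.span (Set.range (X : Fin n → MvPolynomial (Fin n) k))) ∧
      RegSeq J rs := by
  obtain ⟨rs, hlen, hmem, hreg⟩ := h
  refine ⟨rs, hlen, hmem, regSeq_of_isWeaklyRegular rs (MvPolynomial (Fin n) k ⧸ J)
    (Submodule.mkQ J) J (Submodule.mkQ_surjective J) (fun x => ?_) ?_⟩
  · rw [Submodule.mkQ_apply, Submodule.Quotient.mk_eq_zero]
  · rw [← RingTheory.Sequence.isWeaklyRegular_map_algebraMap_iff (MvPolynomial (Fin n) k ⧸ J)]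
    exact hreg.toIsWeaklyRegular

lemma mem_linkIdeal {D : SC n} {σ : Finset (Fin n)} {p : MvPolynomial (Fin n) k} :
    p ∈ linkIdeal k D σ ↔ xFace k σ * p ∈ srIdeal k D := by
  simp [linkIdeal, mul_comm]

lemma xFace_mul_mem_redIdeal {D : SC n} {σ : Finset (Fin n)} {c : Fin d × Fin n → k}
    {p : MvPolynomial (Fin n) k} (hp : p ∈ redIdeal k (linkIdeal k D σ) c) :
    xFace k σ * p ∈ redIdeal k (srIdeal k D) c := by
  obtain ⟨x, hx, y, hy, rfl⟩ := Submodule.mem_sup.1 hp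
  rw [mul_add]
  exact add_mem (Submodule.mem_sup_left (mem_linkIdeal.1 hx))
    (Submodule.mem_sup_right (Ideal.mul_mem_left _ _ hy))

lemma homIdeal_redIdeal {J : Ideal (MvPolynomial (Fin n) k)} (hJ : HomIdeal J)
    (c : Fin d × Fin n → k) : HomIdeal (redIdeal k J c) :=
  hJ.sup <| homIdeal_span <| by
    rintro _ ⟨j, rfl⟩
    exact ⟨1, isHomogeneous_linForm _⟩

/-- The vanishing of a graded component of `k[x] ⧸ (J, f₁, …, f_d)` is an open condition on the
linear forms `f₁, …, f_d`. -/
lemma exists_forall_isHomogeneous_mem {J : Ideal (MvPolynomial (Fin n) k)} (hJ : HomIdeal J)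
    (q : ℕ) {c : Fin d × Fin n → k} (hc : ∀ p, p.IsHomogeneous q → p ∈ redIdeal k J c) :
    ∃ h : MvPolynomial (Fin d × Fin n) k, h ≠ 0 ∧ ∀ c', eval c' h ≠ 0 →
      ∀ p, p.IsHomogeneous q → p ∈ redIdeal k J c' := by
  classical
  let T := Finset.finsuppAntidiag (Finset.univ : Finset (Fin n)) q
  have hT : ∀ m, m ∈ T ↔ m.degree = q := fun m => by
    simp [T, Finsupp.degree_eq_sum, Finset.mem_finsuppAntidiag]
  have hmono : ∀ m : T, ∃ x ∈ J, ∃ g : Fin d → MvPolynomial (Fin n) k,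
      x + ∑ j, g j * linForm k (fun i => c (j, i)) = monomial (m : Fin n →₀ ℕ) 1 := by
    intro m
    obtain ⟨x, hx, y, hy, h⟩ := Submodule.mem_sup.1
      (hc (monomial (m : Fin n →₀ ℕ) 1) (isHomogeneous_monomial _ ((hT m).1 m.2)))
    obtain ⟨g, rfl⟩ := (Ideal.mem_span_range_iff_exists_fun).1 hy
    exact ⟨x, hx, g, h⟩
  choose x hx g hg using hmono
  let r : (Fin d × Fin n → k) → T → MvPolynomial (Fin n) k := fun c' m =>
    x m + ∑ j, g m j * linForm k (fun i => c' (j, i))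
  have hr : ∀ c' m, r c' m ∈ redIdeal k J c' := fun c' m =>
    add_mem (Submodule.mem_sup_left (hx m)) <| Submodule.mem_sup_right <|
      Ideal.mem_span_range_iff_exists_fun.2 ⟨g m, rfl⟩
  let P : Matrix T T (MvPolynomial (Fin d × Fin n) k) := Matrix.of fun m m' =>
    C (coeff (m' : Fin n →₀ ℕ) (x m)) +
      ∑ j, ∑ i, C (coeff (m' : Fin n →₀ ℕ) (g m j * X i)) * X (j, i)
  have hP : ∀ c', eval c' P.det =
      Matrix.det (Matrix.of fun m m' : T => coeff (m' : Fin n →₀ ℕ) (r c' m)) := by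
    intro c'
    rw [RingHom.map_det]
    congr 1
    ext m m'
    simp only [P, r, RingHom.mapMatrix_apply, Matrix.map_apply, Matrix.of_apply, map_add, map_sum,
      map_mul, eval_C, eval_X, coeff_add, coeff_sum, linForm, Finset.mul_sum]
    congr 1
    refine Finset.sum_congr rfl fun j _ => Finset.sum_congr rfl fun i _ => ?_
    rw [mul_left_comm, coeff_C_mul, mul_comm]
  refine ⟨P.det, fun h0 => ?_, fun c' hc' p hp => ?_⟩
  · have h1 := hP c
    have h2 : (Matrix.of fun m m' : T => coeff (m' : Fin n →₀ ℕ) (r c m)) = 1 := by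
      ext m m'
      simp only [r, hg, Matrix.of_apply, coeff_monomial, Matrix.one_apply, Subtype.ext_iff]
    rw [h2, Matrix.det_one, h0, map_zero] at h1
    exact zero_ne_one h1
  · rw [hP] at hc'
    set M : Matrix T T k := Matrix.of fun m m' : T => coeff (m' : Fin n →₀ ℕ) (r c' m) with hM
    have hcomp : ∀ m, homogeneousComponent q (r c' m) =
        ∑ m' : T, C (M m m') * monomial (m' : Fin n →₀ ℕ) 1 := by
      intro m
      ext a
      rw [coeff_homogeneousComponent, coeff_sum]
      simp only [coeff_C_mul, coeff_monomial, mul_ite, mul_one, mul_zero]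
      split_ifs with ha
      · rw [Finset.sum_eq_single (⟨a, (hT a).2 ha⟩ : T)]
        · simp [hM]
        · intro m' _ hne
          rw [if_neg fun h => hne (Subtype.ext h)]
        · exact fun h => absurd (Finset.mem_univ _) h
      · refine (Finset.sum_eq_zero fun m' _ => if_neg ?_).symm
        rintro rfl
        exact ha ((hT _).1 m'.2)
    have hmem : ∀ m : T, monomial (m : Fin n →₀ ℕ) (1 : k) ∈ redIdeal k J c' := by
      intro m
      have h1 : ∑ m', C (M⁻¹ m m') * homogeneousComponent q (r c' m') =
          monomial (m : Fin n →₀ ℕ) (1 : k) := by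
        simp only [hcomp, Finset.mul_sum]
        rw [Finset.sum_comm]
        simp only [← mul_assoc, ← C_mul, ← Finset.sum_mul, ← map_sum, ← Matrix.mul_apply,
          Matrix.nonsing_inv_mul M (isUnit_iff_ne_zero.2 hc'), Matrix.one_apply]
        rw [Finset.sum_eq_single m]
        · rw [if_pos rfl, C_1, one_mul]
        · intro m' _ hne
          rw [if_neg hne.symm, C_0, zero_mul]
        · exact fun h => absurd (Finset.mem_univ _) h
      rw [← h1]
      exact sum_mem fun m' _ =>
        Ideal.mul_mem_left _ _ (homIdeal_redIdeal hJ c' _ (hr c' m') q)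
    rw [p.as_sum]
    refine sum_mem fun a ha => ?_
    have hdeg : a.degree = q := by
      have := hp (mem_support_iff.1 ha)
      rwa [Finsupp.degree_eq_weight_one]
    rw [← mul_one (coeff a p), ← C_mul_monomial]
    exact Ideal.mul_mem_left _ _ (hmem ⟨a, (hT a).2 hdeg⟩)

/-- If some form of degree `q` is nonzero modulo `J`, then so is the `q`-th power of a general
linear form, provided that `q!` is invertible. -/
lemma generic_linForm_pow_notMem {J : Ideal (MvPolynomial (Fin n) k)} {q : ℕ}
    (hq : (q.factorial : k) ≠ 0) {p : MvPolynomial (Fin n) k} (hp : p.IsHomogeneous q)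
    (hpJ : p ∉ J) : Generic k (Fin n) fun ω => linForm k ω ^ q ∉ J := by
  classical
  obtain ⟨f, hfp, hfJ⟩ := Submodule.exists_le_ker_of_notMem (p := J.restrictScalars k) hpJ
  obtain ⟨a, ha, hfa⟩ : ∃ a ∈ p.support, f (monomial a 1) ≠ 0 := by
    by_contra! h
    apply hfp
    conv_lhs => rw [p.as_sum]
    rw [map_sum]
    refine Finset.sum_eq_zero fun a ha => ?_
    rw [← mul_one (coeff a p), ← smul_eq_mul, ← smul_monomial, map_smul, h a ha, smul_zero]
  have hdeg : ∑ i, a i = q := by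
    have := hp (mem_support_iff.1 ha)
    rw [← Finsupp.degree_eq_sum, Finsupp.degree_eq_weight_one]
    exact this
  have hpow : ∀ ω : Fin n → k, linForm k ω ^ q = ∑ s ∈ Finset.piAntidiag Finset.univ q,
      ((Nat.multinomial Finset.univ s : k) * ∏ i, ω i ^ s i) • ∏ i, X i ^ s i := by
    intro ω
    rw [linForm, Finset.sum_pow_eq_sum_piAntidiag]
    refine Finset.sum_congr rfl fun s _ => ?_
    simp only [mul_pow, Finset.prod_mul_distrib, smul_eq_C_mul, C_mul, map_prod, map_pow,
      map_natCast, mul_assoc]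
  refine ⟨∑ s ∈ Finset.piAntidiag Finset.univ q,
    C ((Nat.multinomial Finset.univ s : k) * f (∏ i, X i ^ s i)) * ∏ i, X i ^ s i,
    fun h0 => ?_, fun ω hω hmem => hω ?_⟩
  · have h1 := congrArg (coeff a) h0
    rw [coeff_sum, Finset.sum_eq_single (a : Fin n → ℕ), coeff_C_mul, coeff_zero] at h1
    · have hX : ∏ i, X i ^ a i = monomial a (1 : k) := by
        rw [monomial_eq, C_1, one_mul, Finsupp.prod_fintype _ _ fun i => pow_zero _]
      rw [hX, coeff_monomial, if_pos rfl, mul_one] at h1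
      refine (mul_ne_zero (fun h2 => hq ?_) hfa) h1
      rw [← hdeg, ← Nat.multinomial_spec, Nat.cast_mul, h2, mul_zero]
    · intro s _ hs
      have hX : ∏ i, X i ^ s i = monomial (Finsupp.equivFunOnFinite.symm s) (1 : k) := by
        rw [monomial_eq, C_1, one_mul, Finsupp.prod_fintype _ _ fun i => pow_zero _]
        rfl
      rw [coeff_C_mul, hX, coeff_monomial, if_neg, mul_zero]
      rintro rfl
      exact hs rfl
    · intro h
      exact absurd (Finset.mem_piAntidiag.2 ⟨hdeg, fun i _ => Finset.mem_univ i⟩) h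
  · have h1 : f (linForm k ω ^ q) = 0 := hfJ hmem
    rw [hpow, map_sum] at h1
    rw [map_sum, ← h1]
    refine Finset.sum_congr rfl fun s _ => ?_
    simp only [map_mul, eval_C, map_prod, map_pow, eval_X, map_smul, smul_eq_mul]
    ring

/-- For all choices of linear forms, the reduction of the link of a face `σ` of a Gorenstein*
complex does not vanish in the degrees below half of its socle degree. -/
lemma exists_isHomogeneous_notMem [Infinite k] {D : SC n} (hD : gorStar k D)
    {σ : Finset (Fin n)} (hσ : σ ∈ D.faces) {q : ℕ} (hq : σ.card + q ≤ dimP D)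
    (c : Fin (dimP D) × Fin n → k) :
    ∃ p : MvPolynomial (Fin n) k, p.IsHomogeneous q ∧ p ∉ redIdeal k (linkIdeal k D σ) c := by
  by_contra! hc
  obtain ⟨h₁, hh₁, hlink⟩ := exists_forall_isHomogeneous_mem (homIdeal_linkIdeal D σ) q hc
  obtain ⟨-, ⟨⟨-, hdepth⟩, h₂, hh₂, hart⟩, hcone⟩ := hD
  obtain ⟨h₃, hh₃, hdual⟩ := exists_minors (k := k) (dimP D) n
  obtain ⟨rs, hlen, hmem, hreg⟩ := exists_regSeq_of_depthGE hdepth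
  obtain ⟨c', hc', hreg'⟩ := exists_linForms_regSeq (dimP D) (srIdeal k D) rs hlen hmem hreg
    (h₁ * h₂ * h₃) (mul_ne_zero (mul_ne_zero hh₁ hh₂) hh₃)
  rw [map_mul, map_mul, mul_ne_zero_iff, mul_ne_zero_iff] at hc'
  obtain ⟨⟨hc₁, hc₂⟩, hc₃⟩ := hc'
  obtain ⟨hfacet, hne⟩ := xFace_notMem_redIdeal hreg' (hart c' hc₂) (hdual c' hc₃)
    (fun F hF => Finset.le_sup (f := Finset.card) hF) hcone
  obtain ⟨F, hF, hσF, hFd⟩ := hfacet σ hσ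
  obtain ⟨E, hE, hEq⟩ := Finset.exists_subset_card_eq (s := F \ σ) (n := q) (by
    rw [Finset.card_sdiff_of_subset hσF]
    omega)
  refine hne F hF hFd ?_
  have hx : xFace k F = xFace k σ * xFace k E * xFace k ((F \ σ) \ E) := by
    rw [xFace, xFace, xFace, xFace, mul_assoc, mul_comm (∏ i ∈ E, _), Finset.prod_sdiff hE,
      mul_comm, Finset.prod_sdiff hσF]
  rw [hx]
  exact Ideal.mul_mem_right _ _
    (xFace_mul_mem_redIdeal (hlink c' hc₁ _ (hEq ▸ isHomogeneous_xFace E)))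

end Genericity

/-- **Lemma.** If `q > p₁`, or `q = p₁` and `k` has characteristic `0` or a prime
characteristic `> d - q - 1`, then property `M_{q,p₁}` holds for `k[L]`
(i.e. for its general Artinian reduction `B`). -/
theorem propM_of_dim_cond (k : Type) [Field k] [Infinite k]
    (n q d : ℕ) (hq : 1 ≤ q)
    (D : SC n) (hD : gorStar k D)
    (σ : Finset (Fin n)) (hσ : σ ∈ D.faces) (hcard : σ.card = q + 1)
    (hd : d = dimP D)
    (hcond : (d - 1) / 2 < q ∨
      (q = (d - 1) / 2 ∧
        (ringChar k = 0 ∨ ((ringChar k).Prime ∧ d - q - 1 < ringChar k)))) :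
    Generic k (Fin d × Fin n) fun c =>
      propM k (redIdeal k (linkIdeal k D σ) c) q ((d - 1) / 2) := by
  refine ⟨1, one_ne_zero, fun c _ => ?_⟩
  rcases hcond with hlt | ⟨hqd, hchar⟩
  · refine ⟨1, one_ne_zero, fun ω _ x hx _ => ?_⟩
    rw [qCompZ, if_neg (by omega)] at hx
    exact (Submodule.mem_bot k).1 hx
  · subst hd
    have hfact : (q.factorial : k) ≠ 0 := fun h => by
      have hdvd := ringChar.dvd h
      rcases hchar with h0 | ⟨hprime, hlt⟩
      · rw [h0, zero_dvd_iff] at hdvd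
        exact q.factorial_ne_zero hdvd
      · have := (hprime.dvd_factorial).1 hdvd
        omega
    obtain ⟨p, hp, hpJ⟩ := exists_isHomogeneous_notMem hD hσ (q := q) (by omega) c
    obtain ⟨g, hg, hgω⟩ := generic_linForm_pow_notMem hfact hp hpJ
    refine ⟨g, hg, fun ω hω x hx hzero => ?_⟩
    rw [← hqd, sub_self, qCompZ, if_pos le_rfl] at hx
    obtain ⟨y, hy, rfl⟩ := hx
    have hyC := totalDegree_eq_zero_iff_eq_C.1 (Nat.le_zero.1 (IsHomogeneous.totalDegree_le hy))
    by_cases ha : coeff 0 y = 0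
    · rw [hyC, ha, C_0, map_zero]
    · refine absurd ?_ (hgω ω hω)
      rw [hyC] at hzero
      change Ideal.Quotient.mk _ (linForm k ω) ^ q * Ideal.Quotient.mk _ (C (coeff 0 y)) = 0
        at hzero
      rw [← map_pow, ← map_mul, Ideal.Quotient.eq_zero_iff_mem] at hzero
      have h1 := Ideal.mul_mem_right (C (coeff 0 y)⁻¹) _ hzero
      rwa [mul_assoc, ← C_mul, mul_inv_cancel₀ ha, C_1, mul_one] at h1

end SRWLP
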